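/- Define δ(n) by ∑_{n≥0} δ(n) q^n = (-q^2,-q^3;q^5)_∞^2 (q^2,q^8;q^{10})_∞ / ((-q,-q^4;q^5)_∞^2 (q,q^9;q^{10})_∞). Then δ(5n+4)=0 for all n≥0. -/

import Mathlib

/-- Euler's product E(q) = ∏_{k≥0} (1 - q^{k+1}). -/
noncomputable def E (q : ℂ) : ℂ := ∏' k : ℕ, (1 - q ^ (k + 1))

/-- q-Pochhammer infinite product (a;q)_∞ = ∏_{k≥0} (1 - a q^k). -/
noncomputable def qp (a q : ℂ) : ℂ := ∏' k : ℕ, (1 - a * q ^ k)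

/-- Rogers–Ramanujan function G(q) = 1/((q,q^4;q^5)_∞). -/
noncomputable def G (q : ℂ) : ℂ := 1 / (qp q (q ^ 5) * qp (q ^ 4) (q ^ 5))

/-- Rogers–Ramanujan function H(q) = 1/((q^2,q^3;q^5)_∞). -/
noncomputable def H (q : ℂ) : ℂ := 1 / (qp (q ^ 2) (q ^ 5) * qp (q ^ 3) (q ^ 5))

/-- Rogers–Ramanujan continued fraction product R(q). -/
noncomputable def R (q : ℂ) : ℂ :=
  (qp q (q ^ 5) * qp (q ^ 4) (q ^ 5)) / (qp (q ^ 2) (q ^ 5) * qp (q ^ 3) (q ^ 5))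

section JacobiTriple

theorem HasSum.congr_val {ι : Type*} {f : ι → ℂ} {a b : ℂ} (h : HasSum f a) (e : b = a) :
    HasSum f b := e ▸ h

/-- The binomial exponent `n (n - 1) / 2` for integers `n`. -/
def tri (n : ℤ) : ℤ := n * (n - 1) / 2

theorem two_mul_tri (n : ℤ) : 2 * tri n = n * (n - 1) := by
  refine Int.mul_ediv_cancel' ?_
  rcases Int.even_or_odd n with h | h
  · exact (h.mul_right _).two_dvd
  · exact ((h.sub_odd odd_one).mul_left _).two_dvd

theorem tri_add (n k : ℤ) : tri (n + k) = tri n + tri k + n * k := by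
  have h1 := two_mul_tri n
  have h2 := two_mul_tri k
  have h3 := two_mul_tri (n + k)
  nlinarith

theorem tri_neg (n : ℤ) : tri (-n) = tri n + n := by
  have h1 := two_mul_tri n
  have h2 := two_mul_tri (-n)
  nlinarith

@[simp] theorem tri_zero : tri 0 = 0 := rfl

@[simp] theorem tri_one : tri 1 = 0 := rfl

/-- The coefficients `(-1)^n p^(n (n - 1) / 2)` of the theta series. -/
noncomputable def thetaCoeff (p : ℂ) (n : ℤ) : ℂ := (-1) ^ n * p ^ tri n

theorem thetaCoeff_add {p : ℂ} (hp : p ≠ 0) (n k : ℤ) :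
    thetaCoeff p (n + k) = thetaCoeff p n * thetaCoeff p k * p ^ (n * k) := by
  have h1 : (-1 : ℂ) ≠ 0 := by norm_num
  simp only [thetaCoeff, tri_add, zpow_add₀ hp, zpow_add₀ h1]
  ring

theorem neg_one_zpow_neg (n : ℤ) : (-1 : ℂ) ^ (-n) = (-1) ^ n := by
  rw [zpow_neg, ← inv_zpow, inv_neg_one]

theorem thetaCoeff_ne_zero {p : ℂ} (hp : p ≠ 0) (n : ℤ) : thetaCoeff p n ≠ 0 :=
  mul_ne_zero (zpow_ne_zero _ (by norm_num)) (zpow_ne_zero _ hp)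

theorem thetaCoeff_neg {p : ℂ} (hp : p ≠ 0) (n : ℤ) :
    thetaCoeff p (-n) = thetaCoeff p n * p ^ n := by
  simp only [thetaCoeff, tri_neg, zpow_add₀ hp, neg_one_zpow_neg]
  ring

@[simp] theorem thetaCoeff_zero (p : ℂ) : thetaCoeff p 0 = 1 := by simp [thetaCoeff]

theorem summable_thetaCoeff_nat {p : ℂ} (hp : p ≠ 0) (hp1 : ‖p‖ < 1) (z : ℂ) :
    Summable fun n : ℕ => ‖thetaCoeff p n * z ^ n‖ := by
  by_cases hz : z = 0
  · refine summable_of_ne_finset_zero (s := {0}) fun n hn => ?_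
    simp [hz, show n ≠ 0 by simpa using hn]
  refine summable_of_ratio_test_tendsto_lt_one (l := 0) one_pos ?_ ?_
  · refine Filter.Eventually.of_forall fun n => ?_
    simpa using ⟨thetaCoeff_ne_zero hp n, fun h => absurd h hz⟩
  · have h : ∀ n : ℕ, ‖‖thetaCoeff p (n + 1 : ℕ) * z ^ (n + 1)‖‖ / ‖‖thetaCoeff p n * z ^ n‖‖
        = ‖z‖ * ‖p‖ ^ n := by
      intro n
      have h0 : ‖thetaCoeff p n‖ ≠ 0 := by simpa using thetaCoeff_ne_zero hp n
      have hz' : ‖z‖ ≠ 0 := by simpa using hz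
      have h1 : ‖thetaCoeff p 1‖ = 1 := by simp [thetaCoeff]
      push_cast
      rw [thetaCoeff_add hp, mul_one, zpow_natCast]
      simp only [norm_norm, norm_mul, norm_pow, h1, pow_succ]
      field_simp
      simp
    simp only [h]
    simpa using (tendsto_pow_atTop_nhds_zero_of_lt_one (norm_nonneg p) hp1).const_mul ‖z‖

theorem summable_norm_thetaCoeff {p : ℂ} (hp : p ≠ 0) (hp1 : ‖p‖ < 1) (z : ℂ) :
    Summable fun n : ℤ => ‖thetaCoeff p n * z ^ n‖ := by
  refine Summable.of_nat_of_neg (by simpa using summable_thetaCoeff_nat hp hp1 z) ?_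
  refine (summable_thetaCoeff_nat hp hp1 (p * z⁻¹)).congr fun n => ?_
  rw [thetaCoeff_neg hp, mul_pow, zpow_neg, inv_pow]
  simp [mul_assoc]

/-- The theta series `∑ (-1)^n p^(n (n - 1) / 2) z^n`. -/
noncomputable def thetaSeries (p z : ℂ) : ℂ := ∑' n : ℤ, thetaCoeff p n * z ^ n

theorem hasSum_thetaSeries {p : ℂ} (hp : p ≠ 0) (hp1 : ‖p‖ < 1) (z : ℂ) :
    HasSum (fun n : ℤ => thetaCoeff p n * z ^ n) (thetaSeries p z) :=
  (summable_norm_thetaCoeff hp hp1 z).of_norm.hasSum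

/-- `1 / (p;p)_m`, extended by zero to negative `m`. -/
noncomputable def invPoch (p : ℂ) (m : ℤ) : ℂ :=
  if 0 ≤ m then (∏ k ∈ Finset.range m.toNat, (1 - p ^ (k + 1)))⁻¹ else 0

theorem one_sub_pow_ne_zero {p : ℂ} (hp1 : ‖p‖ < 1) (k : ℕ) : 1 - p ^ (k + 1) ≠ 0 := by
  intro h
  have h1 : ‖p ^ (k + 1)‖ < 1 := by
    rw [norm_pow]
    exact pow_lt_one₀ (norm_nonneg _) hp1 (Nat.succ_ne_zero k)
  rw [← sub_eq_zero.mp h] at h1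
  simp at h1

theorem invPoch_sub_one {p : ℂ} (hp1 : ‖p‖ < 1) (m : ℤ) :
    invPoch p (m - 1) = (1 - p ^ m) * invPoch p m := by
  rcases lt_trichotomy m 0 with h | rfl | h
  · simp [invPoch, not_le.mpr h, show ¬ (1 ≤ m) by lia]
  · simp [invPoch]
  · obtain ⟨k, rfl⟩ : ∃ k : ℕ, m = k + 1 := ⟨(m - 1).toNat, by lia⟩
    have h0 := one_sub_pow_ne_zero hp1 k
    have h1 : (k + 1 : ℤ).toNat = k + 1 := by lia
    have h2 : p ^ (k + 1 : ℤ) = p ^ (k + 1) := by exact_mod_cast zpow_natCast p (k + 1)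
    simp only [invPoch, add_sub_cancel_right, Int.toNat_natCast, h1, h2, Finset.prod_range_succ,
      mul_inv]
    rw [if_pos (by lia), if_pos (by lia)]
    field_simp

theorem multipliable_qp (a : ℂ) {q : ℂ} (hq : ‖q‖ < 1) :
    Multipliable fun k : ℕ => 1 - a * q ^ k := by
  simp only [sub_eq_add_neg]
  refine multipliable_one_add_of_summable ?_
  simpa using (summable_geometric_of_lt_one (norm_nonneg q) hq).mul_left ‖a‖

theorem qp_ne_zero {a q : ℂ} (hq : ‖q‖ < 1) (h : ∀ k : ℕ, 1 - a * q ^ k ≠ 0) : qp a q ≠ 0 := by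
  have := tprod_one_add_ne_zero_of_summable (f := fun k : ℕ => -(a * q ^ k))
    (fun k => by simpa [sub_eq_add_neg] using h k)
    (by simpa using (summable_geometric_of_lt_one (norm_nonneg q) hq).mul_left ‖a‖)
  simpa [qp, sub_eq_add_neg] using this

theorem tendsto_qp (a : ℂ) {q : ℂ} (hq : ‖q‖ < 1) :
    Filter.Tendsto (fun N => ∏ k ∈ Finset.range N, (1 - a * q ^ k)) Filter.atTop
      (nhds (qp a q)) :=
  (multipliable_qp a hq).hasProd.tendsto_prod_nat

theorem qp_self_ne_zero {p : ℂ} (hp1 : ‖p‖ < 1) : qp p p ≠ 0 :=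
  qp_ne_zero hp1 fun k => by simpa [pow_succ'] using one_sub_pow_ne_zero hp1 k

theorem tendsto_invPoch {p : ℂ} (hp1 : ‖p‖ < 1) :
    Filter.Tendsto (fun m : ℕ => invPoch p m) Filter.atTop (nhds (qp p p)⁻¹) := by
  have := (tendsto_qp p hp1).inv₀ (qp_self_ne_zero hp1)
  simpa [invPoch, pow_succ'] using this

theorem exists_norm_invPoch_le {p : ℂ} (hp1 : ‖p‖ < 1) : ∃ C, 0 ≤ C ∧ ∀ m, ‖invPoch p m‖ ≤ C := by
  obtain ⟨C, hC⟩ := (tendsto_invPoch hp1).norm.bddAbove_range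
  refine ⟨max C 0, le_max_right _ _, fun m => ?_⟩
  by_cases h : 0 ≤ m
  · lift m to ℕ using h
    exact (hC ⟨m, rfl⟩).trans (le_max_left _ _)
  · simp [invPoch, h]

/-- Coefficients of the finite Jacobi triple product. -/
noncomputable def finiteCoeff (p : ℂ) (N : ℕ) (n : ℤ) : ℂ :=
  thetaCoeff p n * ((∏ k ∈ Finset.range (2 * N), (1 - p ^ (k + 1))) *
    (invPoch p (N + n) * invPoch p (N - n)))

theorem finiteCoeff_succ {p : ℂ} (hp : p ≠ 0) (hp1 : ‖p‖ < 1) (N : ℕ) (n : ℤ) :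
    finiteCoeff p (N + 1) n = (1 + p ^ (2 * N + 1)) * finiteCoeff p N n
      - p ^ N * finiteCoeff p N (n - 1) - p ^ (N + 1) * finiteCoeff p N (n + 1) := by
  have e1 := invPoch_sub_one hp1 (N + 1 + n)
  have e2 := invPoch_sub_one hp1 (N + n)
  have e3 := invPoch_sub_one hp1 (N + 1 - n)
  have e4 := invPoch_sub_one hp1 (N - n)
  have t1 : thetaCoeff p (n - 1) = -thetaCoeff p n * (p ^ n)⁻¹ * p := by
    have h1 : thetaCoeff p (-1) = -p := by
      rw [thetaCoeff_neg hp]; simp [thetaCoeff]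
    rw [sub_eq_add_neg, thetaCoeff_add hp, h1]
    simp
    ring
  have t2 : thetaCoeff p (n + 1) = -thetaCoeff p n * p ^ n := by
    rw [thetaCoeff_add hp]
    simp [thetaCoeff]
  rw [show (N : ℤ) + 1 + n - 1 = N + n by ring] at e1
  rw [show (N : ℤ) + 1 - n - 1 = N - n by ring] at e3
  simp only [finiteCoeff]
  rw [show 2 * (N + 1) = 2 * N + 1 + 1 by ring, Finset.prod_range_succ, Finset.prod_range_succ,
    t1, t2, show (N : ℤ) + (n - 1) = N + n - 1 by ring, show (N : ℤ) - (n - 1) = N + 1 - n by ring,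
    show (N : ℤ) + (n + 1) = N + 1 + n by ring, show (N : ℤ) - (n + 1) = N - n - 1 by ring, e2, e4,
    e1, e3]
  push_cast
  have hn : p ^ n ≠ 0 := zpow_ne_zero _ hp
  simp only [zpow_add₀ hp, zpow_sub₀ hp, zpow_natCast, zpow_one, pow_succ, pow_mul', pow_zero]
  field_simp
  ring_nf

theorem hasSum_finiteCoeff {p z : ℂ} (hp : p ≠ 0) (hp1 : ‖p‖ < 1) (hz : z ≠ 0) (N : ℕ) :
    HasSum (fun n : ℤ => finiteCoeff p N n * z ^ n)
      ((∏ k ∈ Finset.range N, (1 - z * p ^ k)) * ∏ k ∈ Finset.range N, (1 - p / z * p ^ k)) := by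
  induction N with
  | zero =>
    have h := hasSum_single (f := fun n : ℤ => finiteCoeff p 0 n * z ^ n) 0 (fun n hn => by
      rcases lt_or_gt_of_ne hn with h | h
      · simp [finiteCoeff, invPoch, not_le.mpr h]
      · simp [finiteCoeff, invPoch, not_le.mpr h])
    simpa [finiteCoeff, invPoch] using h
  | succ N ih =>
    have h1 : HasSum (fun n : ℤ => finiteCoeff p N (n - 1) * z ^ n) _ :=
      (((Equiv.subRight (1 : ℤ)).hasSum_iff.mpr ih).mul_left z).congr_fun fun n => by
        simp [zpow_sub₀ hz]
        field_simp
    have h2 : HasSum (fun n : ℤ => finiteCoeff p N (n + 1) * z ^ n) _ :=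
      (((Equiv.addRight (1 : ℤ)).hasSum_iff.mpr ih).mul_left z⁻¹).congr_fun fun n => by
        simp [zpow_add₀ hz]
        field_simp
    have h3 := ((ih.mul_left (1 + p ^ (2 * N + 1))).sub (h1.mul_left (p ^ N))).sub
      (h2.mul_left (p ^ (N + 1)))
    have h4 : HasSum (fun n : ℤ => finiteCoeff p (N + 1) n * z ^ n) _ := h3.congr_fun fun n => by
      rw [finiteCoeff_succ hp hp1]
      ring
    refine h4.congr_val ?_
    rw [Finset.prod_range_succ, Finset.prod_range_succ]
    field_simp
    ring

/-- The theta product `(z;p)_∞ (p/z;p)_∞`. -/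
noncomputable def theta (p z : ℂ) : ℂ := qp z p * qp (p / z) p

/-- **Jacobi triple product identity**. -/
theorem theta_eq {p z : ℂ} (hp : p ≠ 0) (hp1 : ‖p‖ < 1) (hz : z ≠ 0) :
    theta p z = (qp p p)⁻¹ * thetaSeries p z := by
  have hE := qp_self_ne_zero hp1
  have hlim := (tendsto_qp z hp1).mul (tendsto_qp (p / z) hp1)
  refine tendsto_nhds_unique hlim ?_
  simp only [← (hasSum_finiteCoeff hp hp1 hz _).tsum_eq]
  rw [thetaSeries, ← tsum_mul_left]
  obtain ⟨C, hC0, hC⟩ := exists_norm_invPoch_le hp1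
  have hprod : Filter.Tendsto (fun N : ℕ => ∏ k ∈ Finset.range (2 * N), (1 - p ^ (k + 1)))
      Filter.atTop (nhds (qp p p)) := by
    have := (tendsto_qp p hp1).comp (Filter.tendsto_id.const_mul_atTop' (two_pos : (0 : ℕ) < 2))
    simpa [Function.comp_def, pow_succ'] using this
  obtain ⟨D, hD⟩ := hprod.norm.bddAbove_range
  refine tendsto_tsum_of_dominated_convergence
    (bound := fun n => D * (C * C) * ‖thetaCoeff p n * z ^ n‖)
    ((summable_norm_thetaCoeff hp hp1 z).mul_left _) (fun n => ?_)
    (Filter.Eventually.of_forall fun N n => ?_)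
  · have hcast : ∀ s : ℤ, Filter.Tendsto (fun N : ℕ => invPoch p (N + s)) Filter.atTop
        (nhds (qp p p)⁻¹) := by
      intro s
      have h1 : Filter.Tendsto (fun N : ℕ => ((N : ℤ) + s).toNat) Filter.atTop Filter.atTop := by
        refine Filter.tendsto_atTop.mpr fun b => ?_
        filter_upwards [Filter.eventually_ge_atTop (b + s.natAbs)] with N hN
        lia
      refine ((tendsto_invPoch hp1).comp h1).congr' ?_
      filter_upwards [Filter.eventually_ge_atTop s.natAbs] with N hN
      simp only [Function.comp_apply]
      congr 1
      lia
    have h := ((hprod.mul ((hcast n).mul (hcast (-n)))).const_mul (thetaCoeff p n)).mul_const (z ^ n)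
    simp only [finiteCoeff]
    convert h using 2
    · simp only [sub_eq_add_neg]
    · field_simp
  · rw [finiteCoeff, mul_right_comm, norm_mul, mul_comm]
    refine mul_le_mul_of_nonneg_right ?_ (norm_nonneg _)
    rw [norm_mul, norm_mul]
    exact mul_le_mul (hD ⟨N, rfl⟩) (mul_le_mul (hC _) (hC _) (norm_nonneg _) hC0)
      (by positivity) ((norm_nonneg _).trans (hD ⟨N, rfl⟩))

end JacobiTriple

section ThetaProduct

theorem qp_eq_mul {a p : ℂ} (hp1 : ‖p‖ < 1) : qp a p = (1 - a) * qp (a * p) p := by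
  have h := tprod_eq_zero_mul' (f := fun k : ℕ => 1 - a * p ^ k)
    (by simpa [pow_succ', mul_assoc] using multipliable_qp (a * p) hp1)
  simpa [qp, pow_succ', mul_assoc] using h

theorem qp_mul_qp_neg (a : ℂ) {p : ℂ} (hp1 : ‖p‖ < 1) :
    qp a p * qp (-a) p = qp (a ^ 2) (p ^ 2) := by
  rw [qp, qp, ← (multipliable_qp a hp1).tprod_mul (multipliable_qp (-a) hp1)]
  refine tprod_congr fun k => ?_
  ring

theorem norm_sq_lt_one {p : ℂ} (hp1 : ‖p‖ < 1) : ‖p ^ 2‖ < 1 := by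
  rw [norm_pow]
  exact pow_lt_one₀ (norm_nonneg _) hp1 two_ne_zero

theorem qp_eq_even_mul_odd (a : ℂ) {p : ℂ} (hp1 : ‖p‖ < 1) :
    qp a p = qp a (p ^ 2) * qp (a * p) (p ^ 2) := by
  have h1 : Multipliable fun k : ℕ => 1 - a * p ^ (2 * k) := by
    simpa only [pow_mul] using multipliable_qp a (norm_sq_lt_one hp1)
  have h2 : Multipliable fun k : ℕ => 1 - a * p ^ (2 * k + 1) := by
    refine (multipliable_qp (a * p) (norm_sq_lt_one hp1)).congr fun k => ?_
    ring
  refine (tprod_even_mul_odd (f := fun k : ℕ => 1 - a * p ^ k) h1 h2).symm.trans ?_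
  refine congrArg₂ _ (tprod_congr fun k => ?_) (tprod_congr fun k => ?_) <;> ring

theorem theta_div {p : ℂ} (hp : p ≠ 0) (z : ℂ) : theta p (p / z) = theta p z := by
  rw [theta, theta, div_div_cancel₀ hp, mul_comm]

theorem theta_one {p : ℂ} (hp1 : ‖p‖ < 1) : theta p 1 = 0 := by
  rw [theta, qp_eq_mul hp1]
  simp

theorem theta_mul_left {p z : ℂ} (hp : p ≠ 0) (hp1 : ‖p‖ < 1) (hz : z ≠ 0) :
    theta p (p * z) = -z⁻¹ * theta p z := by
  rw [theta, theta, qp_eq_mul (a := z) hp1, qp_eq_mul (a := p / (p * z)) hp1,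
    show p / (p * z) * p = p / z by field_simp, mul_comm z p]
  field_simp
  ring

theorem theta_ne_zero {p z : ℂ} (hp1 : ‖p‖ < 1) (hz : ‖p‖ < ‖z‖) (hz1 : ‖z‖ ≤ 1) (h1 : z ≠ 1) :
    theta p z ≠ 0 := by
  have key : ∀ w k, ‖w * p ^ k‖ < 1 → 1 - w * p ^ k ≠ 0 := fun w k h h0 => by
    rw [← sub_eq_zero.mp h0] at h
    simp at h
  refine mul_ne_zero (qp_ne_zero hp1 fun k => ?_) (qp_ne_zero hp1 fun k => key _ _ ?_)
  · cases k with
    | zero => simpa [sub_eq_zero] using h1.symm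
    | succ k =>
      refine key _ _ ?_
      rw [norm_mul, norm_pow]
      exact (mul_le_of_le_one_left (by positivity) hz1).trans_lt
        (pow_lt_one₀ (norm_nonneg _) hp1 k.succ_ne_zero)
  · rw [norm_mul, norm_pow, norm_div]
    refine (mul_le_of_le_one_right (by positivity)
      (pow_le_one₀ (norm_nonneg _) hp1.le)).trans_lt ?_
    rwa [div_lt_one ((norm_nonneg _).trans_lt hz)]

theorem theta_mul_theta_neg {p : ℂ} (hp1 : ‖p‖ < 1) (z : ℂ) :
    theta p z * theta p (-z) = theta (p ^ 2) (z ^ 2) := by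
  rw [theta, theta, theta, ← qp_mul_qp_neg z hp1, ← div_pow, ← qp_mul_qp_neg (p / z) hp1, div_neg]
  ring

theorem theta_eq_mul {p : ℂ} (hp : p ≠ 0) (hp1 : ‖p‖ < 1) (z : ℂ) :
    theta p z = theta (p ^ 2) z * theta (p ^ 2) (z * p) := by
  by_cases hz : z = 0
  · simp [hz, theta, qp]
  rw [theta, theta, theta, qp_eq_even_mul_odd z hp1, qp_eq_even_mul_odd (p / z) hp1,
    show p ^ 2 / (z * p) = p / z by field_simp, show p ^ 2 / z = p / z * p by ring]
  ring

theorem theta_neg_one_mul {p : ℂ} (hp : p ≠ 0) (hp1 : ‖p‖ < 1) :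
    theta p (-1) * theta (p ^ 2) p = 2 := by
  have h0 := qp_self_ne_zero (norm_sq_lt_one hp1)
  have h1 := qp_eq_even_mul_odd p hp1
  have h2 := qp_mul_qp_neg p hp1
  have h3 : qp p (p ^ 2) * qp (-p) p = 1 := by
    rw [h1, ← pow_two] at h2
    refine mul_left_cancel₀ h0 ?_
    linear_combination h2
  rw [theta, theta, qp_eq_mul hp1, show p ^ 2 / p = p by field_simp]
  simp only [neg_mul, one_mul, div_neg, div_one]
  linear_combination (2 * (qp p (p ^ 2) * qp (-p) p) + 2) * h3

end ThetaProduct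

section Plucker

/-- The two-dimensional family of which the products `θ(xy) θ(x/y)` are minors. -/
noncomputable def evenTheta (p x : ℂ) : ℂ := ∑' n : ℤ, p ^ (n ^ 2) * x ^ (2 * n)

/-- The odd companion of `evenTheta`. -/
noncomputable def oddTheta (p x : ℂ) : ℂ := ∑' n : ℤ, p ^ (n ^ 2 + n) * x ^ (2 * n + 1)

theorem sq_eq_two_mul_tri (n : ℤ) : n ^ 2 = 2 * tri n + n := by
  rw [two_mul_tri]
  ring

theorem summable_evenTheta {p x : ℂ} (hp : p ≠ 0) (hp1 : ‖p‖ < 1) :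
    Summable fun n : ℤ => ‖p ^ (n ^ 2) * x ^ (2 * n)‖ := by
  have h := summable_norm_thetaCoeff (pow_ne_zero 2 hp) (norm_sq_lt_one hp1) (p * x ^ 2)
  refine h.congr fun n => ?_
  rw [sq_eq_two_mul_tri, zpow_add₀ hp, zpow_mul, zpow_mul]
  simp [thetaCoeff, mul_zpow, mul_assoc]

theorem summable_oddTheta {p x : ℂ} (hp : p ≠ 0) (hp1 : ‖p‖ < 1) (hx : x ≠ 0) :
    Summable fun n : ℤ => ‖p ^ (n ^ 2 + n) * x ^ (2 * n + 1)‖ := by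
  have h := summable_norm_thetaCoeff (pow_ne_zero 2 hp) (norm_sq_lt_one hp1) (p ^ 2 * x ^ 2)
  refine (h.mul_right ‖x‖).congr fun n => ?_
  rw [show n ^ 2 + n = 2 * tri n + 2 * n by rw [sq_eq_two_mul_tri]; ring, zpow_add₀ hp,
    zpow_add₀ hx, zpow_mul, zpow_mul, zpow_mul]
  simp [thetaCoeff, mul_zpow, mul_assoc]

/-- Splitting pairs of integers by the parity of their sum. -/
noncomputable def paritySplit : (ℤ × ℤ) ⊕ (ℤ × ℤ) ≃ ℤ × ℤ :=
  Equiv.ofBijective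
    (Sum.elim (fun v => (v.1 + v.2 + 1, v.1 - v.2 + 1)) fun v => (v.1 + v.2 + 1, v.1 - v.2)) <| by
    constructor
    · rintro (⟨a, b⟩ | ⟨a, b⟩) (⟨c, d⟩ | ⟨c, d⟩) h <;>
        simp only [Sum.elim_inl, Sum.elim_inr, Prod.mk.injEq, Sum.inl.injEq, Sum.inr.injEq,
          reduceCtorEq] at h ⊢ <;> lia
    · rintro ⟨m, n⟩
      obtain ⟨k, hk⟩ | ⟨k, hk⟩ := Int.even_or_odd (m + n)
      · refine ⟨Sum.inl (k - 1, m - k), ?_⟩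
        simp only [Sum.elim_inl, Prod.mk.injEq]
        lia
      · refine ⟨Sum.inr (k, m - k - 1), ?_⟩
        simp only [Sum.elim_inr, Prod.mk.injEq]
        lia

theorem thetaCoeff_mul_thetaCoeff {p x y : ℂ} (hp : p ≠ 0) (hx : x ≠ 0) (hy : y ≠ 0) (m n : ℤ) :
    thetaCoeff p m * (x * y) ^ m * (thetaCoeff p n * (x / y) ^ n) =
      (-1) ^ (m + n) * p ^ (tri m + tri n) * x ^ (m + n) * y ^ (m - n) := by
  have h1 : (-1 : ℂ) ≠ 0 := by norm_num
  simp only [thetaCoeff, mul_zpow, div_zpow, zpow_add₀ hp, zpow_add₀ hx, zpow_sub₀ hy,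
    zpow_add₀ h1]
  ring

theorem hasSum_mul_of_summable_norm {f g : ℤ → ℂ} (hf : Summable fun n => ‖f n‖)
    (hg : Summable fun n => ‖g n‖) :
    HasSum (fun v : ℤ × ℤ => f v.1 * g v.2) ((∑' n, f n) * ∑' n, g n) := by
  rw [tsum_mul_tsum_of_summable_norm hf hg]
  exact (summable_mul_of_summable_norm hf hg).hasSum

theorem thetaSeries_mul_thetaSeries {p x y : ℂ} (hp : p ≠ 0) (hp1 : ‖p‖ < 1) (hx : x ≠ 0)
    (hy : y ≠ 0) :
    thetaSeries p (x * y) * thetaSeries p (x / y) =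
      x * (oddTheta p x * evenTheta p y - evenTheta p x * oddTheta p y) := by
  have h1 := summable_norm_thetaCoeff hp hp1 (x * y)
  have h2 := summable_norm_thetaCoeff hp hp1 (x / y)
  have ex := summable_evenTheta (x := x) hp hp1
  have ey := summable_evenTheta (x := y) hp hp1
  have ox := summable_oddTheta hp hp1 hx
  have oy := summable_oddTheta hp hp1 hy
  have e1 := (hasSum_mul_of_summable_norm ox ey).mul_left x
  have e2 := (hasSum_mul_of_summable_norm ex oy).mul_left (-x)
  have h0 := hasSum_mul_of_summable_norm h1 h2
  have h3 := paritySplit.hasSum_iff.mpr h0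
  have key : ∀ m n : ℤ, ∀ r t : ℤ, m = r + t + 1 → n = r - t + 1 →
      thetaCoeff p m * (x * y) ^ m * (thetaCoeff p n * (x / y) ^ n) =
      x * (p ^ (r ^ 2 + r) * x ^ (2 * r + 1) * (p ^ (t ^ 2) * y ^ (2 * t))) := by
    intro m n r t hm hn
    have i1 : tri m + tri n = (r ^ 2 + r) + t ^ 2 := by
      have := two_mul_tri m
      have := two_mul_tri n
      subst hm hn
      linarith
    rw [thetaCoeff_mul_thetaCoeff hp hx hy, i1, zpow_add₀ hp,
      show m + n = 2 * r + 1 + 1 by lia, show m - n = 2 * t by lia, zpow_add_one₀ hx,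
      Even.neg_one_zpow ⟨r + 1, by ring⟩]
    ring
  have key' : ∀ m n : ℤ, ∀ r t : ℤ, m = r + t + 1 → n = r - t →
      thetaCoeff p m * (x * y) ^ m * (thetaCoeff p n * (x / y) ^ n) =
      -x * (p ^ (r ^ 2) * x ^ (2 * r) * (p ^ (t ^ 2 + t) * y ^ (2 * t + 1))) := by
    intro m n r t hm hn
    have i1 : tri m + tri n = r ^ 2 + (t ^ 2 + t) := by
      have := two_mul_tri m
      have := two_mul_tri n
      subst hm hn
      linarith
    rw [thetaCoeff_mul_thetaCoeff hp hx hy, i1, zpow_add₀ hp,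
      show m + n = 2 * r + 1 by lia, show m - n = 2 * t + 1 by lia, zpow_add_one₀ hx,
      Odd.neg_one_zpow ⟨r, rfl⟩]
    ring
  have e3 := h3.unique (HasSum.sum (e1.congr_fun fun v => key _ _ v.1 v.2 rfl rfl)
    (e2.congr_fun fun v => key' _ _ v.1 v.2 rfl rfl))
  simp only [thetaSeries, oddTheta, evenTheta]
  rw [e3]
  ring

/-- The three-term relation of Weierstrass. -/
theorem theta_weierstrass {p x y z w : ℂ} (hp : p ≠ 0) (hp1 : ‖p‖ < 1) (hx : x ≠ 0) (hy : y ≠ 0)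
    (hz : z ≠ 0) (hw : w ≠ 0) :
    z / y * (theta p (y * x) * theta p (y / x)) * (theta p (w * z) * theta p (w / z)) -
      (theta p (z * x) * theta p (z / x)) * (theta p (w * y) * theta p (w / y)) +
      (theta p (w * x) * theta p (w / x)) * (theta p (z * y) * theta p (z / y)) = 0 := by
  have key : ∀ u v : ℂ, u ≠ 0 → v ≠ 0 → theta p (u * v) * theta p (u / v) = (qp p p)⁻¹ ^ 2 *
      (u * (oddTheta p u * evenTheta p v - evenTheta p u * oddTheta p v)) := by
    intro u v hu hv
    rw [← thetaSeries_mul_thetaSeries hp hp1 hu hv, theta_eq hp hp1 (mul_ne_zero hu hv),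
      theta_eq hp hp1 (div_ne_zero hu hv)]
    ring
  rw [key _ _ hy hx, key _ _ hw hz, key _ _ hz hx, key _ _ hw hy, key _ _ hw hx, key _ _ hz hy]
  field_simp
  ring

end Plucker

section Lambert

/-- The partial theta series `∑_{n ≥ 0} (-1)^n p^(n (n - 1) / 2) w^n`. -/
noncomputable def partialTheta (p w : ℂ) : ℂ := ∑' n : ℕ, thetaCoeff p n * w ^ n

theorem hasSum_partialTheta {p : ℂ} (hp : p ≠ 0) (hp1 : ‖p‖ < 1) (w : ℂ) :
    HasSum (fun n : ℕ => thetaCoeff p n * w ^ n) (partialTheta p w) :=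
  (summable_thetaCoeff_nat hp hp1 w).of_norm.hasSum

theorem thetaCoeff_add_one {p : ℂ} (hp : p ≠ 0) (n : ℤ) :
    thetaCoeff p (n + 1) = -thetaCoeff p n * p ^ n := by
  rw [thetaCoeff_add hp]
  simp [thetaCoeff]

theorem partialTheta_eq {p : ℂ} (hp : p ≠ 0) (hp1 : ‖p‖ < 1) (w : ℂ) :
    partialTheta p w = 1 - w * partialTheta p (p * w) := by
  have h := (hasSum_nat_add_iff' 1).mpr (hasSum_partialTheta hp hp1 w)
  have h2 := h.unique (((hasSum_partialTheta hp hp1 (p * w)).mul_left (-w)).congr_fun fun n => by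
    push_cast
    rw [thetaCoeff_add_one hp, zpow_natCast, mul_pow]
    ring)
  simp only [Finset.range_one, Finset.sum_singleton, Nat.cast_zero, thetaCoeff_zero, pow_zero,
    mul_one] at h2
  linear_combination h2

theorem exists_norm_partialTheta_le {p : ℂ} (hp : p ≠ 0) (hp1 : ‖p‖ < 1) :
    ∃ M, 0 ≤ M ∧ ∀ w, ‖w‖ ≤ 1 → ‖partialTheta p w‖ ≤ M := by
  have hs : Summable fun n : ℕ => ‖thetaCoeff p n‖ := by
    simpa using summable_thetaCoeff_nat hp hp1 1
  refine ⟨∑' n : ℕ, ‖thetaCoeff p n‖, tsum_nonneg fun _ => norm_nonneg _, fun w hw => ?_⟩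
  refine tsum_of_norm_bounded hs.hasSum fun n => ?_
  rw [norm_mul, norm_pow]
  exact mul_le_of_le_one_right (norm_nonneg _) (pow_le_one₀ (norm_nonneg _) hw)

theorem thetaSeries_one {p : ℂ} (hp : p ≠ 0) (hp1 : ‖p‖ < 1) : thetaSeries p 1 = 0 := by
  have h := theta_eq hp hp1 one_ne_zero
  rw [theta_one hp1, eq_comm, mul_eq_zero] at h
  exact h.resolve_left (inv_ne_zero (qp_self_ne_zero hp1))

theorem thetaSeries_eq_zpow_mul {p z : ℂ} (hp : p ≠ 0) (hp1 : ‖p‖ < 1) (hz : z ≠ 0) (n : ℤ) :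
    thetaSeries p z = thetaCoeff p n * z ^ n * thetaSeries p (z * p ^ n) := by
  have h := (Equiv.addLeft n).hasSum_iff.mpr (hasSum_thetaSeries hp hp1 z)
  refine h.unique (((hasSum_thetaSeries hp hp1 (z * p ^ n)).mul_left
    (thetaCoeff p n * z ^ n)).congr_fun fun k => ?_)
  simp only [Function.comp_apply, Equiv.coe_addLeft]
  rw [thetaCoeff_add hp, zpow_add₀ hz, mul_zpow, zpow_mul]
  ring

theorem thetaSeries_zpow {p : ℂ} (hp : p ≠ 0) (hp1 : ‖p‖ < 1) (n : ℤ) :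
    thetaSeries p (p ^ n) = 0 := by
  have h := thetaSeries_eq_zpow_mul hp hp1 one_ne_zero n
  rw [thetaSeries_one hp hp1, eq_comm, mul_eq_zero, one_mul] at h
  exact h.resolve_left (mul_ne_zero (thetaCoeff_ne_zero hp n) (zpow_ne_zero n one_ne_zero))

theorem thetaSeries_eq_partialTheta_add {p w : ℂ} (hp : p ≠ 0) (hp1 : ‖p‖ < 1) (hw : w ≠ 0) :
    thetaSeries p w = partialTheta p w + partialTheta p (p / w) - 1 := by
  have h1 := hasSum_partialTheta hp hp1 w
  have h2 := (hasSum_partialTheta hp hp1 (p / w)).congr_fun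
    (g := fun n : ℕ => thetaCoeff p (-n) * w ^ (-(n : ℤ))) fun n => by
      rw [thetaCoeff_neg hp, zpow_neg, zpow_natCast, zpow_natCast, div_pow]
      field_simp
  have h3 := (hasSum_thetaSeries hp hp1 w).unique
    (HasSum.of_nat_of_neg (by simpa using h1) (by simpa using h2))
  simpa using h3

/-- The values `∑_{n ≥ 0} (-1)^n p^(n (n - 1) / 2) p^((1 - k) n)`. -/
noncomputable def thetaTail (p : ℂ) (k : ℤ) : ℂ := partialTheta p (p ^ (1 - k))

theorem thetaTail_eq {p : ℂ} (hp : p ≠ 0) (hp1 : ‖p‖ < 1) (k : ℤ) :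
    thetaTail p k = 1 - p ^ (1 - k) * thetaTail p (k - 1) := by
  rw [thetaTail, partialTheta_eq hp hp1, thetaTail]
  congr 3
  rw [← zpow_one_add₀ hp]
  ring_nf

theorem thetaTail_add {p : ℂ} (hp : p ≠ 0) (hp1 : ‖p‖ < 1) (k : ℤ) :
    thetaTail p k + thetaTail p (1 - k) = 1 := by
  have h := thetaSeries_eq_partialTheta_add hp hp1 (zpow_ne_zero (1 - k) hp)
  rw [thetaSeries_zpow hp hp1] at h
  have h1 : p / p ^ (1 - k) = p ^ (1 - (1 - k)) := by rw [zpow_sub₀ hp 1 (1 - k), zpow_one]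
  rw [h1] at h
  rw [thetaTail, thetaTail]
  linear_combination -h

theorem exists_norm_thetaTail_le {p : ℂ} (hp : p ≠ 0) (hp1 : ‖p‖ < 1) :
    ∃ M, 0 ≤ M ∧ (∀ n : ℕ, ‖thetaTail p n‖ ≤ M * ‖p‖ ^ n) ∧
      (∀ n : ℕ, ‖thetaTail p (-n)‖ ≤ M) := by
  obtain ⟨M, hM0, hM⟩ := exists_norm_partialTheta_le hp hp1
  have h1 : ∀ n : ℕ, ‖thetaTail p (-n)‖ ≤ M := fun n => by
    refine hM _ ?_
    rw [show 1 - -(n : ℤ) = (n + 1 : ℕ) by push_cast; ring, zpow_natCast, norm_pow]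
    exact pow_le_one₀ (norm_nonneg _) hp1.le
  refine ⟨M, hM0, fun n => ?_, h1⟩
  have h2 := thetaTail_add hp hp1 n
  have h3 := thetaTail_eq hp hp1 (1 - n)
  rw [show 1 - (1 - (n : ℤ)) = n by ring, show 1 - (n : ℤ) - 1 = -n by ring, zpow_natCast] at h3
  rw [show thetaTail p n = p ^ n * thetaTail p (-n) by linear_combination h2 - h3, norm_mul,
    norm_pow, mul_comm]
  exact mul_le_mul_of_nonneg_right (h1 n) (by positivity)

theorem exists_forall_norm_thetaTail_le {p : ℂ} (hp : p ≠ 0) (hp1 : ‖p‖ < 1) :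
    ∃ M, ∀ n, ‖thetaTail p n‖ ≤ M := by
  obtain ⟨M, hM0, h1, h2⟩ := exists_norm_thetaTail_le hp hp1
  refine ⟨M, fun n => ?_⟩
  obtain ⟨n, rfl | rfl⟩ := n.eq_nat_or_neg
  · exact (h1 n).trans (mul_le_of_le_one_right hM0 (pow_le_one₀ (norm_nonneg _) hp1.le))
  · exact h2 n

theorem summable_norm_thetaCoeff_mul_thetaTail {p : ℂ} (hp : p ≠ 0) (hp1 : ‖p‖ < 1) (z : ℂ) :
    Summable fun n : ℤ => ‖thetaCoeff p n * thetaTail p n * z ^ n‖ := by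
  obtain ⟨M, hM⟩ := exists_forall_norm_thetaTail_le hp hp1
  refine Summable.of_nonneg_of_le (fun _ => norm_nonneg _) (fun n => ?_)
    ((summable_norm_thetaCoeff hp hp1 z).mul_left M)
  rw [mul_right_comm, norm_mul, mul_comm]
  exact mul_le_mul_of_nonneg_right (hM n) (norm_nonneg _)

theorem thetaSeries_eq_one_sub_mul {p z : ℂ} (hp : p ≠ 0) (hp1 : ‖p‖ < 1) (hz : z ≠ 0) :
    thetaSeries p z = (1 - z) * ∑' n : ℤ, thetaCoeff p n * thetaTail p n * z ^ n := by
  have h := (summable_norm_thetaCoeff_mul_thetaTail hp hp1 z).of_norm.hasSum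
  have h1 := ((Equiv.subRight (1 : ℤ)).hasSum_iff.mpr h).mul_left z
  have h2 := (hasSum_thetaSeries hp hp1 z).unique ((h.sub h1).congr_fun fun n => by
    have e1 := thetaTail_eq hp hp1 n
    have e2 := thetaCoeff_add_one hp (n - 1)
    rw [sub_add_cancel] at e2
    have e3 : p ^ (n - 1) * p ^ (1 - n) = 1 := by
      rw [← zpow_add₀ hp]; simp
    simp only [Function.comp_apply, Equiv.subRight_apply]
    have e4 : z ^ n = z * z ^ (n - 1) := by rw [← zpow_one_add₀ hz]; ring_nf
    rw [e1, e2, e4]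
    linear_combination (-(thetaCoeff p (n - 1) * thetaTail p (n - 1) * z * z ^ (n - 1))) * e3)
  rw [h2]
  ring

theorem summable_norm_thetaTail {p a : ℂ} (hp : p ≠ 0) (hp1 : ‖p‖ < 1) (ha : ‖p‖ < ‖a‖)
    (ha1 : ‖a‖ < 1) : Summable fun n : ℤ => ‖thetaTail p n * a ^ (-n)‖ := by
  obtain ⟨M, hM0, h1, h2⟩ := exists_norm_thetaTail_le hp hp1
  have ha0 : 0 < ‖a‖ := (norm_nonneg _).trans_lt ha
  refine Summable.of_nat_of_neg ?_ ?_
  · refine Summable.of_nonneg_of_le (fun _ => norm_nonneg _) (fun n => ?_)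
      ((summable_geometric_of_lt_one (by positivity) ((div_lt_one ha0).mpr ha)).mul_left M)
    rw [norm_mul, norm_zpow, zpow_neg, zpow_natCast, div_pow, ← mul_div_assoc, ← div_eq_mul_inv]
    gcongr
    exact h1 n
  · refine Summable.of_nonneg_of_le (fun _ => norm_nonneg _) (fun n => ?_)
      ((summable_geometric_of_lt_one ha0.le ha1).mul_left M)
    rw [norm_mul, norm_zpow, neg_neg, zpow_natCast]
    gcongr
    exact h2 n

/-- The sum `∑ e_k a^(-k)` over the values `e_k` of `thetaTail`. -/
noncomputable def tailSeries (p a : ℂ) : ℂ := ∑' n : ℤ, thetaTail p n * a ^ (-n)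

/-- The bilateral Lambert series `∑ a^n / (1 - b p^n)`. -/
noncomputable def lambert (p a b : ℂ) : ℂ := ∑' n : ℤ, a ^ n / (1 - b * p ^ n)

theorem hasSum_lambert_mul {p a b : ℂ} (hp : p ≠ 0) (hp1 : ‖p‖ < 1) (ha : ‖p‖ < ‖a‖)
    (ha1 : ‖a‖ < 1) (hb0 : b ≠ 0) (hb : ∀ n : ℤ, 1 - b * p ^ n ≠ 0) :
    HasSum (fun n : ℤ => a ^ n / (1 - b * p ^ n) * thetaSeries p b)
      (thetaSeries p (a * b) * tailSeries p a) := by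
  have ha0 : a ≠ 0 := norm_pos_iff.mp ((norm_nonneg _).trans_lt ha)
  have h := hasSum_mul_of_summable_norm (summable_norm_thetaCoeff hp hp1 (a * b))
    (summable_norm_thetaTail hp hp1 ha ha1)
  let e : ℤ × ℤ ≃ ℤ × ℤ :=
    { toFun := fun v => (v.1 + v.2, v.2)
      invFun := fun v => (v.1 - v.2, v.2)
      left_inv := fun v => by simp
      right_inv := fun v => by simp }
  have h1 := e.hasSum_iff.mpr h
  refine h1.prod_fiberwise fun n => ?_
  have hz : b * p ^ n ≠ 0 := mul_ne_zero hb0 (zpow_ne_zero n hp)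
  have h2 := (summable_norm_thetaCoeff_mul_thetaTail hp hp1 (b * p ^ n)).of_norm.hasSum.mul_left
    (a ^ n * (thetaCoeff p n * b ^ n))
  refine (h2.congr_fun fun k => ?_).congr_val ?_
  · simp only [Function.comp_apply, e, Equiv.coe_fn_mk]
    rw [thetaCoeff_add hp, mul_zpow, mul_zpow, zpow_add₀ ha0, zpow_add₀ hb0, zpow_neg, zpow_mul]
    have := zpow_ne_zero k ha0
    field_simp
  · rw [thetaSeries_eq_zpow_mul hp hp1 hb0 n, thetaSeries_eq_one_sub_mul hp hp1 hz]
    have := hb n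
    field_simp

theorem lambert_mul_thetaSeries {p a b : ℂ} (hp : p ≠ 0) (hp1 : ‖p‖ < 1) (ha : ‖p‖ < ‖a‖)
    (ha1 : ‖a‖ < 1) (hb0 : b ≠ 0) (hb : ∀ n : ℤ, 1 - b * p ^ n ≠ 0) :
    lambert p a b * thetaSeries p b = thetaSeries p (a * b) * tailSeries p a := by
  rw [lambert, ← tsum_mul_right]
  exact (hasSum_lambert_mul hp hp1 ha ha1 hb0 hb).tsum_eq

end Lambert

section Kronecker

theorem one_sub_mul_zpow_ne_zero {p b : ℂ} (hp : p ≠ 0) (hp1 : ‖p‖ < 1) (hb : ‖p‖ < ‖b‖)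
    (hb1 : ‖b‖ < 1) (n : ℤ) : 1 - b * p ^ n ≠ 0 := by
  intro h
  have hb2 : b = p ^ (-n) := by
    rw [zpow_neg]
    refine eq_inv_of_mul_eq_one_left ?_
    linear_combination -h
  rcases le_or_gt (-n) 0 with h0 | h0
  · have : 1 ≤ ‖b‖ := by
      rw [hb2, norm_zpow]
      exact one_le_zpow_of_nonpos₀ (norm_pos_iff.mpr hp) hp1.le h0
    linarith
  · obtain ⟨k, hk⟩ : ∃ k : ℕ, -n = (k + 1 : ℕ) := ⟨(-n - 1).toNat, by lia⟩
    rw [hb2, hk, zpow_natCast, norm_pow, pow_succ] at hb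
    have := mul_le_of_le_one_left (norm_nonneg p) (pow_le_one₀ (n := k) (norm_nonneg p) hp1.le)
    linarith

/-- The double series `∑ a^n b^m p^(n m)` over natural numbers. -/
noncomputable def doubleSeries (p a b : ℂ) : ℂ :=
  ∑' v : ℕ × ℕ, a ^ v.1 * b ^ v.2 * p ^ (v.1 * v.2)

theorem doubleSeries_comm (p a b : ℂ) : doubleSeries p a b = doubleSeries p b a := by
  rw [doubleSeries, ← (Equiv.prodComm ℕ ℕ).tsum_eq]
  refine tsum_congr fun v => ?_
  simp only [Equiv.prodComm_apply, Prod.fst_swap, Prod.snd_swap]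
  rw [mul_comm v.2, mul_comm (a ^ v.2)]

theorem hasSum_doubleSeries {p a b : ℂ} (hp1 : ‖p‖ < 1) (ha1 : ‖a‖ < 1) (hb1 : ‖b‖ < 1) :
    HasSum (fun n : ℕ => a ^ n / (1 - b * p ^ n)) (doubleSeries p a b) := by
  have hs : Summable fun v : ℕ × ℕ => a ^ v.1 * b ^ v.2 * p ^ (v.1 * v.2) := by
    refine Summable.of_norm_bounded ((summable_geometric_of_lt_one (norm_nonneg a)
      ha1).mul_of_nonneg (summable_geometric_of_lt_one (norm_nonneg b) hb1)
      (fun _ => by positivity) fun _ => by positivity) fun v => ?_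
    rw [norm_mul, norm_mul, norm_pow, norm_pow, norm_pow]
    exact mul_le_of_le_one_right (by positivity) (pow_le_one₀ (norm_nonneg _) hp1.le)
  refine hs.hasSum.prod_fiberwise fun n => ?_
  have hbn : ‖b * p ^ n‖ < 1 := by
    rw [norm_mul, norm_pow]
    exact (mul_le_of_le_one_right (by positivity) (pow_le_one₀ (norm_nonneg _) hp1.le)).trans_lt hb1
  refine ((hasSum_geometric_of_norm_lt_one hbn).mul_left (a ^ n)).congr_fun fun m => ?_
  rw [mul_pow, ← pow_mul, mul_assoc]

theorem hasSum_lambert {p a b : ℂ} (hp : p ≠ 0) (hp1 : ‖p‖ < 1) (ha : ‖p‖ < ‖a‖) (ha1 : ‖a‖ < 1)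
    (hb : ‖p‖ < ‖b‖) (hb1 : ‖b‖ < 1) :
    HasSum (fun n : ℤ => a ^ n / (1 - b * p ^ n))
      (doubleSeries p a b + -(p / (a * b)) * doubleSeries p (p / a) (p / b)) := by
  have ha0 := (norm_nonneg _).trans_lt ha
  have hb0 := (norm_nonneg _).trans_lt hb
  have ha2 : ‖p / a‖ < 1 := by rwa [norm_div, div_lt_one ha0]
  have hb2 : ‖p / b‖ < 1 := by rwa [norm_div, div_lt_one hb0]
  rw [norm_pos_iff] at ha0 hb0
  refine HasSum.of_nat_of_neg_add_one (by simpa using hasSum_doubleSeries hp1 ha1 hb1)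
    (((hasSum_doubleSeries hp1 ha2 hb2).mul_left (-(p / (a * b)))).congr_fun fun n => ?_)
  have h1 := one_sub_mul_zpow_ne_zero hp hp1 hb hb1 (-((n : ℤ) + 1))
  have h2 : 1 - p / b * p ^ n = -(p ^ (n + 1) / b) * (1 - b * p ^ (-((n : ℤ) + 1))) := by
    rw [zpow_neg, zpow_add_one₀ hp, zpow_natCast]
    field_simp
    ring
  rw [h2, zpow_neg a, zpow_add_one₀ ha0, zpow_natCast, div_pow, pow_succ]
  field_simp

theorem lambert_comm {p a b : ℂ} (hp : p ≠ 0) (hp1 : ‖p‖ < 1) (ha : ‖p‖ < ‖a‖) (ha1 : ‖a‖ < 1)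
    (hb : ‖p‖ < ‖b‖) (hb1 : ‖b‖ < 1) : lambert p a b = lambert p b a := by
  rw [lambert, lambert, (hasSum_lambert hp hp1 ha ha1 hb hb1).tsum_eq,
    (hasSum_lambert hp hp1 hb hb1 ha ha1).tsum_eq, doubleSeries_comm p a,
    doubleSeries_comm p (p / a), mul_comm a]

theorem norm_thetaTail_sub_le {p : ℂ} (hp : p ≠ 0) (hp1 : ‖p‖ < 1) :
    ∃ M, 0 ≤ M ∧ ∀ k : ℤ, ‖thetaTail p k - thetaTail p (k + 1)‖ ≤ M * ‖p‖ ^ k.natAbs := by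
  obtain ⟨M, hM0, h1, -⟩ := exists_norm_thetaTail_le hp hp1
  have h2 : ∀ n : ℕ, ‖thetaTail p n - thetaTail p (n + 1)‖ ≤ 2 * M * ‖p‖ ^ n := fun n => by
    refine (norm_sub_le _ _).trans ?_
    have h3 := h1 (n + 1)
    push_cast at h3
    have h4 : M * ‖p‖ ^ (n + 1) ≤ M * ‖p‖ ^ n :=
      mul_le_mul_of_nonneg_left (pow_le_pow_of_le_one (norm_nonneg _) hp1.le n.le_succ) hM0
    linarith [h1 n]
  refine ⟨2 * M, by positivity, fun k => ?_⟩
  obtain ⟨n, rfl | rfl⟩ := k.eq_nat_or_neg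
  · simpa using h2 n
  · have e1 := thetaTail_add hp hp1 (-n)
    have e2 := thetaTail_add hp hp1 (-n + 1)
    rw [show 1 - -(n : ℤ) = n + 1 by ring] at e1
    rw [show 1 - (-(n : ℤ) + 1) = n by ring] at e2
    rw [show thetaTail p (-n) - thetaTail p (-n + 1) = thetaTail p n - thetaTail p (n + 1) by
      linear_combination e1 - e2]
    simpa using h2 n

theorem summable_pow_natAbs {r : ℝ} (hr0 : 0 ≤ r) (hr : r < 1) :
    Summable fun k : ℤ => r ^ k.natAbs :=
  Summable.of_nat_of_neg (by simpa using summable_geometric_of_lt_one hr0 hr)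
    (by simpa using summable_geometric_of_lt_one hr0 hr)

theorem tsum_thetaTail_sub {p : ℂ} (hp : p ≠ 0) (hp1 : ‖p‖ < 1) :
    ∑' k : ℤ, (thetaTail p k - thetaTail p (k + 1)) = 1 := by
  obtain ⟨M, hM0, hM⟩ := norm_thetaTail_sub_le hp hp1
  obtain ⟨C, hC0, hC, -⟩ := exists_norm_thetaTail_le hp hp1
  have hs : Summable fun k : ℤ => thetaTail p k - thetaTail p (k + 1) :=
    Summable.of_norm_bounded ((summable_pow_natAbs (norm_nonneg _) hp1).mul_left M) hM
  have hlim : Filter.Tendsto (fun n : ℕ => thetaTail p n) Filter.atTop (nhds 0) :=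
    squeeze_zero_norm hC (by
      simpa using (tendsto_pow_atTop_nhds_zero_of_lt_one (norm_nonneg _) hp1).const_mul C)
  have h1 : HasSum (fun n : ℕ => thetaTail p n - thetaTail p (n + 1)) (thetaTail p 0) := by
    have hs1 : Summable fun n : ℕ => thetaTail p n - thetaTail p (n + 1) :=
      hs.comp_injective (i := fun n : ℕ => (n : ℤ)) Nat.cast_injective
    refine hs1.hasSum_iff_tendsto_nat.mpr ?_
    have h := Finset.sum_range_sub' (fun n : ℕ => thetaTail p n)
    push_cast at h
    simp only [h]
    simpa using hlim.const_sub (thetaTail p 0)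
  have h2 : HasSum (fun n : ℕ => thetaTail p (-(n + 1)) - thetaTail p (-(n + 1) + 1))
      (thetaTail p 1) := by
    have h3 := (hasSum_nat_add_iff' 1).mpr h1
    have h4 := h3.congr_fun
      (g := fun n : ℕ => thetaTail p (-(n + 1)) - thetaTail p (-(n + 1) + 1)) fun n => by
      have e1 := thetaTail_add hp hp1 (-((n : ℤ) + 1))
      have e2 := thetaTail_add hp hp1 (-((n : ℤ) + 1) + 1)
      rw [show 1 - -((n : ℤ) + 1) = n + 1 + 1 by ring] at e1
      rw [show 1 - (-((n : ℤ) + 1) + 1) = n + 1 by ring] at e2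
      push_cast
      linear_combination e1 - e2
    simpa using h4
  have h3 := (HasSum.of_nat_of_neg_add_one
    (f := fun k : ℤ => thetaTail p k - thetaTail p (k + 1)) h1 h2).tsum_eq
  have h4 := thetaTail_add hp hp1 0
  rw [h3]
  simpa using h4

theorem hasSum_one_sub_mul_tailSeries {p a : ℂ} (hp : p ≠ 0) (hp1 : ‖p‖ < 1) (ha : ‖p‖ < ‖a‖)
    (ha1 : ‖a‖ < 1) :
    HasSum (fun k : ℤ => (thetaTail p k - thetaTail p (k + 1)) * a ^ (-k))
      ((1 - a) * tailSeries p a) := by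
  have ha0 : a ≠ 0 := norm_pos_iff.mp ((norm_nonneg _).trans_lt ha)
  have h := (summable_norm_thetaTail hp hp1 ha ha1).of_norm.hasSum
  have h1 := ((Equiv.addRight (1 : ℤ)).hasSum_iff.mpr h).mul_left a
  refine ((h.sub h1).congr_fun fun k => ?_).congr_val ?_
  · simp only [Function.comp_apply, Equiv.coe_addRight]
    rw [show -k = -(k + 1) + 1 by ring, zpow_add_one₀ ha0]
    ring
  · rw [tailSeries]
    ring

theorem exists_tailSeries_ne_zero {p : ℂ} (hp : p ≠ 0) (hp1 : ‖p‖ < 1) :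
    ∃ a, ‖p‖ < ‖a‖ ∧ ‖a‖ < 1 ∧ tailSeries p a ≠ 0 := by
  by_contra! hcon
  obtain ⟨M, hM0, hM⟩ := norm_thetaTail_sub_le hp hp1
  obtain ⟨s, hs, hs1⟩ := exists_between hp1
  have hs0 : 0 < s := (norm_nonneg _).trans_lt hs
  have hev : ∀ᶠ t : ℝ in nhdsWithin 1 (Set.Iio 1), s < t ∧ t < 1 :=
    (eventually_nhdsWithin_of_eventually_nhds (eventually_gt_nhds hs1)).and
      self_mem_nhdsWithin
  have hlim : Filter.Tendsto
      (fun t : ℝ => ∑' k : ℤ, (thetaTail p k - thetaTail p (k + 1)) * (t : ℂ) ^ (-k))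
      (nhdsWithin 1 (Set.Iio 1)) (nhds (∑' k : ℤ, (thetaTail p k - thetaTail p (k + 1)))) := by
    refine tendsto_tsum_of_dominated_convergence
      (bound := fun k : ℤ => M * (‖p‖ / s) ^ k.natAbs)
      ((summable_pow_natAbs (by positivity) ((div_lt_one hs0).mpr hs)).mul_left M) (fun k => ?_) ?_
    · have h1 : ContinuousAt (fun t : ℝ => (t : ℂ) ^ (-k)) 1 :=
        (Complex.continuous_ofReal.continuousAt).zpow₀ _ (Or.inl (by simp))
      have h2 := (h1.tendsto.mono_left (nhdsWithin_le_nhds (s := Set.Iio 1))).const_mul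
        (thetaTail p k - thetaTail p (k + 1))
      simpa using h2
    · filter_upwards [hev] with t ht k
      have ht0 : 0 < t := hs0.trans ht.1
      rw [norm_mul, norm_zpow, Complex.norm_real, Real.norm_of_nonneg ht0.le, div_pow,
        ← mul_div_assoc, div_eq_mul_inv]
      refine mul_le_mul (hM k) ?_ (by positivity) (by positivity)
      obtain ⟨n, rfl | rfl⟩ := k.eq_nat_or_neg
      · rw [zpow_neg, zpow_natCast, Int.natAbs_natCast]
        exact inv_anti₀ (by positivity) (pow_le_pow_left₀ hs0.le ht.1.le n)
      · rw [neg_neg, zpow_natCast, Int.natAbs_neg, Int.natAbs_natCast]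
        exact (pow_le_one₀ ht0.le ht.2.le).trans
          ((one_le_inv₀ (by positivity)).mpr (pow_le_one₀ hs0.le hs1.le))
  have hzero : Filter.Tendsto
      (fun t : ℝ => ∑' k : ℤ, (thetaTail p k - thetaTail p (k + 1)) * (t : ℂ) ^ (-k))
      (nhdsWithin 1 (Set.Iio 1)) (nhds 0) := by
    refine tendsto_const_nhds.congr' ?_
    filter_upwards [hev] with t ht
    have ht0 : ‖(t : ℂ)‖ = t := by
      rw [Complex.norm_real, Real.norm_of_nonneg (hs0.trans ht.1).le]
    rw [(hasSum_one_sub_mul_tailSeries hp hp1 (by linarith [ht.1]) (by linarith [ht.2])).tsum_eq,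
      hcon t (by linarith [ht.1]) (by linarith [ht.2]), mul_zero]
  have h := tendsto_nhds_unique hlim hzero
  rw [tsum_thetaTail_sub hp hp1] at h
  exact one_ne_zero h

theorem theta_ne_zero_of_sq_lt {p z : ℂ} (hp : p ≠ 0) (hp1 : ‖p‖ < 1) (hz : ‖p‖ ^ 2 < ‖z‖)
    (hz1 : ‖z‖ < 1) (h : z ≠ p) : theta p z ≠ 0 := by
  have hp0 : 0 < ‖p‖ := norm_pos_iff.mpr hp
  rcases lt_or_ge ‖p‖ ‖z‖ with h1 | h1
  · refine theta_ne_zero hp1 h1 hz1.le ?_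
    rintro rfl
    simp at hz1
  · have hz0 : z ≠ 0 := norm_pos_iff.mp ((by positivity : 0 ≤ ‖p‖ ^ 2).trans_lt hz)
    have hzp : z = p * (z / p) := by field_simp
    rw [hzp, theta_mul_left hp hp1 (div_ne_zero hz0 hp)]
    refine mul_ne_zero (neg_ne_zero.mpr (inv_ne_zero (div_ne_zero hz0 hp)))
      (theta_ne_zero hp1 ?_ ?_ ?_)
    · rw [norm_div, lt_div_iff₀ hp0, ← sq]
      exact hz
    · rw [norm_div]
      exact (div_le_one hp0).mpr h1
    · rwa [Ne, div_eq_one_iff_eq hp]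

theorem tailSeries_mul_thetaSeries_eq {p a b : ℂ} (hp : p ≠ 0) (hp1 : ‖p‖ < 1) (ha : ‖p‖ < ‖a‖)
    (ha1 : ‖a‖ < 1) (hb : ‖p‖ < ‖b‖) (hb1 : ‖b‖ < 1) (hab : a * b ≠ p) :
    tailSeries p a * thetaSeries p a = tailSeries p b * thetaSeries p b := by
  have ha0 : 0 < ‖a‖ := (norm_nonneg _).trans_lt ha
  have hb0 : 0 < ‖b‖ := (norm_nonneg _).trans_lt hb
  have h1 := lambert_mul_thetaSeries hp hp1 ha ha1 (norm_pos_iff.mp hb0)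
    (one_sub_mul_zpow_ne_zero hp hp1 hb hb1)
  have h2 := lambert_mul_thetaSeries hp hp1 hb hb1 (norm_pos_iff.mp ha0)
    (one_sub_mul_zpow_ne_zero hp hp1 ha ha1)
  rw [lambert_comm hp hp1 hb hb1 ha ha1, mul_comm b] at h2
  have h3 : theta p (a * b) ≠ 0 := by
    refine theta_ne_zero_of_sq_lt hp hp1 ?_ ?_ hab
    · rw [norm_mul, sq]
      exact mul_lt_mul'' ha hb (norm_nonneg _) (norm_nonneg _)
    · rw [norm_mul]
      exact mul_lt_one_of_nonneg_of_lt_one_left ha0.le ha1 hb1.le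
  rw [theta_eq hp hp1 (mul_ne_zero (norm_pos_iff.mp ha0) (norm_pos_iff.mp hb0))] at h3
  refine mul_left_cancel₀ (right_ne_zero_of_mul h3) ?_
  linear_combination thetaSeries p b * h2 - thetaSeries p a * h1

theorem exists_annulus_mul_ne {p : ℂ} (hp1 : ‖p‖ < 1) {a b : ℂ} (ha : a ≠ 0) (hb : b ≠ 0) :
    ∃ c : ℂ, ‖p‖ < ‖c‖ ∧ ‖c‖ < 1 ∧ a * c ≠ p ∧ b * c ≠ p := by
  obtain ⟨t, ht, ht1⟩ := (((Set.Ioo_infinite hp1).image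
    Complex.ofReal_injective.injOn)).exists_notMem_finset {p / a, p / b}
  obtain ⟨s, hs, rfl⟩ := ht
  have hs0 : ‖(s : ℂ)‖ = s := by
    rw [Complex.norm_real, Real.norm_of_nonneg ((norm_nonneg _).trans hs.1.le)]
  simp only [Finset.mem_insert, Finset.mem_singleton, not_or] at ht1
  refine ⟨s, by linarith [hs.1], by linarith [hs.2], fun h => ht1.1 ?_, fun h => ht1.2 ?_⟩
  · rw [← h]; field_simp
  · rw [← h]; field_simp

/-- **Kronecker's formula** for the bilateral Lambert series, up to the value of the constant. -/
theorem exists_lambert_eq {p : ℂ} (hp : p ≠ 0) (hp1 : ‖p‖ < 1) :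
    ∃ κ ≠ 0, ∀ a b, ‖p‖ < ‖a‖ → ‖a‖ < 1 → ‖p‖ < ‖b‖ → ‖b‖ < 1 →
      lambert p a b = κ * (theta p (a * b) / (theta p a * theta p b)) := by
  obtain ⟨c, hc, hc1, hc2⟩ := exists_tailSeries_ne_zero hp hp1
  have hne : ∀ a : ℂ, ‖p‖ < ‖a‖ → a ≠ 0 := fun a ha => norm_pos_iff.mp ((norm_nonneg _).trans_lt ha)
  have hth : ∀ a, ‖p‖ < ‖a‖ → ‖a‖ < 1 → theta p a ≠ 0 := fun a ha ha1 =>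
    theta_ne_zero hp1 ha ha1.le (by rintro rfl; simp at ha1)
  have hE := qp_self_ne_zero hp1
  refine ⟨tailSeries p c * theta p c, mul_ne_zero hc2 (hth c hc hc1),
    fun a b ha ha1 hb hb1 => ?_⟩
  obtain ⟨d, hd, hd1, hd2, hd3⟩ := exists_annulus_mul_ne hp1 (hne a ha) (hne c hc)
  have h1 := (tailSeries_mul_thetaSeries_eq hp hp1 ha ha1 hd hd1 hd2).trans
    (tailSeries_mul_thetaSeries_eq hp hp1 hc hc1 hd hd1 hd3).symm
  have h2 := lambert_mul_thetaSeries hp hp1 ha ha1 (hne b hb)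
    (one_sub_mul_zpow_ne_zero hp hp1 hb hb1)
  have ta := hth a ha ha1
  have tb := hth b hb hb1
  rw [theta_eq hp hp1 (hne _ ha)] at ta ⊢
  rw [theta_eq hp hp1 (hne _ hb)] at tb ⊢
  have ta1 := right_ne_zero_of_mul ta
  have tb1 := right_ne_zero_of_mul tb
  rw [theta_eq hp hp1 (mul_ne_zero (hne _ ha) (hne _ hb)), theta_eq hp hp1 (hne _ hc)]
  field_simp
  linear_combination thetaSeries p a * h2 + thetaSeries p (a * b) * h1

end Kronecker

section Dissection

theorem continuousAt_thetaSeries {p z : ℂ} (hp : p ≠ 0) (hp1 : ‖p‖ < 1) (hz : z ≠ 0) :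
    ContinuousAt (thetaSeries p) z := by
  have hz0 : 0 < ‖z‖ := norm_pos_iff.mpr hz
  obtain ⟨r, hr0, hr⟩ := exists_between hz0
  obtain ⟨s, hs⟩ := exists_gt ‖z‖
  have hs0 : 0 < s := hz0.trans hs
  have hU : {w : ℂ | r < ‖w‖ ∧ ‖w‖ < s} ∈ nhds z :=
    ((isOpen_lt continuous_const continuous_norm).inter
      (isOpen_lt continuous_norm continuous_const)).mem_nhds ⟨hr, hs⟩
  refine ContinuousOn.continuousAt (s := {w : ℂ | r < ‖w‖ ∧ ‖w‖ < s}) ?_ hU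
  refine continuousOn_tsum (u := fun n : ℤ => ‖thetaCoeff p n * (s : ℂ) ^ n‖ +
    ‖thetaCoeff p n * (r : ℂ) ^ n‖) (fun n => ?_)
    ((summable_norm_thetaCoeff hp hp1 _).add (summable_norm_thetaCoeff hp hp1 _)) fun n w hw => ?_
  · refine continuousOn_const.mul (continuousOn_id.zpow₀ n fun w hw => Or.inl ?_)
    exact norm_pos_iff.mp (hr0.trans hw.1)
  · have hw0 : 0 < ‖w‖ := hr0.trans hw.1
    simp only [norm_mul, norm_zpow, Complex.norm_real, Real.norm_of_nonneg hs0.le,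
      Real.norm_of_nonneg hr0.le, ← mul_add]
    refine mul_le_mul_of_nonneg_left ?_ (norm_nonneg _)
    obtain ⟨k, rfl | rfl⟩ := n.eq_nat_or_neg
    · simp only [zpow_natCast]
      have := pow_le_pow_left₀ hw0.le hw.2.le k
      have : 0 ≤ r ^ k := by positivity
      linarith
    · simp only [zpow_neg, zpow_natCast]
      have := inv_anti₀ (by positivity) (pow_le_pow_left₀ hr0.le hw.1.le k)
      have : 0 ≤ (s ^ k)⁻¹ := by positivity
      linarith

theorem continuousAt_theta {p z : ℂ} (hp : p ≠ 0) (hp1 : ‖p‖ < 1) (hz : z ≠ 0) :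
    ContinuousAt (theta p) z := by
  refine ((continuousAt_thetaSeries hp hp1 hz).const_mul (qp p p)⁻¹).congr ?_
  filter_upwards [eventually_ne_nhds hz] with w hw
  exact (theta_eq hp hp1 hw).symm

theorem norm_pow_five_lt {p a : ℂ} (hp : p ≠ 0) (hp1 : ‖p‖ < 1) (ha : ‖p‖ < ‖a‖) {r : ℕ}
    (hr : r < 5) : ‖p ^ 5‖ < ‖a * p ^ r‖ := by
  have hp0 : 0 < ‖p‖ := norm_pos_iff.mpr hp
  rw [norm_pow, norm_mul, norm_pow, pow_succ']
  exact (mul_le_mul_of_nonneg_left (pow_le_pow_of_le_one hp0.le hp1.le (by lia : r ≤ 4))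
    hp0.le).trans_lt (mul_lt_mul_of_pos_right ha (by positivity))

theorem norm_mul_pow_le {p : ℂ} (hp1 : ‖p‖ < 1) (a : ℂ) (r : ℕ) : ‖a * p ^ r‖ ≤ ‖a‖ := by
  rw [norm_mul, norm_pow]
  exact mul_le_of_le_one_right (norm_nonneg _) (pow_le_one₀ (norm_nonneg _) hp1.le)

theorem norm_pow_five_lt_one {p : ℂ} (hp1 : ‖p‖ < 1) : ‖p ^ 5‖ < 1 := by
  rw [norm_pow]
  exact pow_lt_one₀ (norm_nonneg _) hp1 (by norm_num)

theorem lambert_eq_sum {p a b : ℂ} (hp : p ≠ 0) (hp1 : ‖p‖ < 1) (ha : ‖p‖ < ‖a‖) (ha1 : ‖a‖ < 1)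
    (hb : ‖p‖ < ‖b‖) (hb1 : ‖b‖ < 1) :
    lambert p a b = ∑ r ∈ Finset.range 5, b ^ r * lambert (p ^ 5) (a * p ^ r) (b ^ 5) := by
  have hb5 : ‖p ^ 5‖ < ‖b ^ 5‖ := by
    rw [norm_pow, norm_pow]
    exact pow_lt_pow_left₀ hb (norm_nonneg _) (by norm_num)
  have hp5 := pow_ne_zero 5 hp
  have hp51 := norm_pow_five_lt_one hp1
  have hb51 := norm_pow_five_lt_one hb1
  have h : ∀ r ∈ Finset.range 5, HasSum (fun n : ℤ => b ^ r * ((a * p ^ r) ^ n /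
      (1 - b ^ 5 * (p ^ 5) ^ n))) (b ^ r * lambert (p ^ 5) (a * p ^ r) (b ^ 5)) := by
    intro r hr
    exact (hasSum_lambert hp5 hp51
      (norm_pow_five_lt hp hp1 ha (Finset.mem_range.mp hr))
      ((norm_mul_pow_le hp1 a r).trans_lt ha1) hb5 hb51).summable.hasSum.mul_left _
  rw [lambert, ← (hasSum_sum h).tsum_eq]
  refine tsum_congr fun n => ?_
  have h1 := one_sub_mul_zpow_ne_zero hp hp1 hb hb1 n
  have h2 := one_sub_mul_zpow_ne_zero hp5 hp51 hb5 hb51 n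
  have h3 : (p ^ 5) ^ n = (p ^ n) ^ 5 := by
    rw [← zpow_natCast, ← zpow_natCast, zpow_comm]
  have h4 : ∀ r : ℕ, (p ^ r) ^ n = (p ^ n) ^ r := fun r => by
    rw [← zpow_natCast, ← zpow_natCast, zpow_comm]
  rw [h3] at h2 ⊢
  simp only [Finset.sum_range_succ, Finset.sum_range_zero, mul_zpow, h4]
  field_simp
  ring

/-- The quotient `θ(ab) / (θ(a) θ(b))`. -/
noncomputable def thetaQuot (p a b : ℂ) : ℂ := theta p (a * b) / (theta p a * theta p b)

theorem continuousAt_thetaQuot {p a b : ℂ} (hp : p ≠ 0) (hp1 : ‖p‖ < 1) (ha : a ≠ 0) (hb : b ≠ 0)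
    (ha0 : theta p a ≠ 0) (hb0 : theta p b ≠ 0) : ContinuousAt (fun x => thetaQuot p x b) a := by
  have h1 : ContinuousAt (fun x => theta p (x * b)) a :=
    ContinuousAt.comp' (f := fun x => x * b) (continuousAt_theta hp hp1 (mul_ne_zero ha hb))
      (by fun_prop)
  exact h1.div ((continuousAt_theta hp hp1 ha).mul continuousAt_const) (mul_ne_zero ha0 hb0)

/-- Five-dissection of theta quotients, with respect to powers of the second argument. -/
theorem exists_thetaQuot_eq_sum {p : ℂ} (hp : p ≠ 0) (hp1 : ‖p‖ < 1) :
    ∃ K ≠ 0, ∀ a b, ‖p‖ < ‖a‖ → ‖a‖ ≤ 1 → a ≠ 1 → ‖p‖ < ‖b‖ → ‖b‖ < 1 →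
      thetaQuot p a b =
        K * ∑ r ∈ Finset.range 5, b ^ r * thetaQuot (p ^ 5) (a * p ^ r) (b ^ 5) := by
  have hp5 := pow_ne_zero 5 hp
  have hp51 := norm_pow_five_lt_one hp1
  obtain ⟨κ, hκ, h1⟩ := exists_lambert_eq hp hp1
  obtain ⟨κ', hκ', h2⟩ := exists_lambert_eq hp5 hp51
  have main : ∀ a b, ‖p‖ < ‖a‖ → ‖a‖ < 1 → ‖p‖ < ‖b‖ → ‖b‖ < 1 → thetaQuot p a b =
      κ' / κ * ∑ r ∈ Finset.range 5, b ^ r * thetaQuot (p ^ 5) (a * p ^ r) (b ^ 5) := by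
    intro a b ha ha1 hb hb1
    have hb5 : ‖p ^ 5‖ < ‖b ^ 5‖ := by
      rw [norm_pow, norm_pow]
      exact pow_lt_pow_left₀ hb (norm_nonneg _) (by norm_num)
    have h3 := lambert_eq_sum hp hp1 ha ha1 hb hb1
    rw [h1 a b ha ha1 hb hb1, Finset.sum_congr rfl fun r hr => by
      rw [h2 _ _ (norm_pow_five_lt hp hp1 ha (Finset.mem_range.mp hr))
        ((norm_mul_pow_le hp1 a r).trans_lt ha1) hb5 (norm_pow_five_lt_one hb1)]] at h3
    simp only [thetaQuot]
    rw [div_mul_eq_mul_div, eq_div_iff hκ, mul_comm, h3, Finset.mul_sum]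
    refine Finset.sum_congr rfl fun r _ => ?_
    ring
  refine ⟨κ' / κ, div_ne_zero hκ' hκ, fun a b ha ha1 h1a hb hb1 => ?_⟩
  rcases ha1.lt_or_eq with ha1 | ha1
  · exact main a b ha ha1 hb hb1
  have ha0 : a ≠ 0 := norm_pos_iff.mp ((norm_nonneg _).trans_lt ha)
  have hb0 : b ≠ 0 := norm_pos_iff.mp ((norm_nonneg _).trans_lt hb)
  have hb5 : ‖p ^ 5‖ < ‖b ^ 5‖ := by
    rw [norm_pow, norm_pow]
    exact pow_lt_pow_left₀ hb (norm_nonneg _) (by norm_num)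
  have hlt : ∀ {x : ℂ}, ‖x‖ < 1 → x ≠ 1 := by
    rintro x hx rfl
    simp at hx
  have hray : Filter.Tendsto (fun t : ℝ => (t : ℂ) * a) (nhdsWithin 1 (Set.Iio 1)) (nhds a) := by
    have : ContinuousAt (fun t : ℝ => (t : ℂ) * a) 1 := by fun_prop
    simpa using this.tendsto.mono_left (nhdsWithin_le_nhds (s := Set.Iio 1))
  have hL := (continuousAt_thetaQuot hp hp1 ha0 hb0 (theta_ne_zero hp1 ha ha1.le h1a)
    (theta_ne_zero hp1 hb hb1.le (hlt hb1))).tendsto.comp hray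
  have hR : Filter.Tendsto (fun x => κ' / κ * ∑ r ∈ Finset.range 5,
      b ^ r * thetaQuot (p ^ 5) (x * p ^ r) (b ^ 5)) (nhds a) (nhds (κ' / κ *
        ∑ r ∈ Finset.range 5, b ^ r * thetaQuot (p ^ 5) (a * p ^ r) (b ^ 5))) := by
    refine (tendsto_finsetSum _ fun r hr => Filter.Tendsto.const_mul _ ?_).const_mul _
    have hne : a * p ^ r ≠ 1 := by
      rcases Nat.eq_zero_or_pos r with rfl | hr0
      · simpa using h1a
      · refine hlt ?_
        rw [norm_mul, norm_pow, ha1, one_mul]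
        exact pow_lt_one₀ (norm_nonneg _) hp1 hr0.ne'
    have hc := continuousAt_thetaQuot hp5 hp51 (mul_ne_zero ha0 (pow_ne_zero r hp))
      (pow_ne_zero 5 hb0) (theta_ne_zero hp51 (norm_pow_five_lt hp hp1 ha
        (Finset.mem_range.mp hr)) ((norm_mul_pow_le hp1 a r).trans ha1.le) hne)
      (theta_ne_zero hp51 hb5 (norm_pow_five_lt_one hb1).le (hlt (norm_pow_five_lt_one hb1)))
    exact hc.tendsto.comp (f := fun x => x * p ^ r) (Continuous.tendsto (by fun_prop) a)
  refine tendsto_nhds_unique hL ((hR.comp hray).congr' ?_)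
  have hev : ∀ᶠ t : ℝ in nhdsWithin 1 (Set.Iio 1), ‖p‖ < t ∧ t < 1 :=
    (eventually_nhdsWithin_of_eventually_nhds (eventually_gt_nhds hp1)).and
      self_mem_nhdsWithin
  filter_upwards [hev] with t ht
  have ht0 : ‖(t : ℂ) * a‖ = t := by
    rw [norm_mul, ha1, mul_one, Complex.norm_real,
      Real.norm_of_nonneg ((norm_nonneg _).trans ht.1.le)]
  exact (main _ b (by rw [ht0]; exact ht.1) (by rw [ht0]; exact ht.2) hb hb1).symm

end Dissection

section Relations

theorem norm_pow_lt_one {Q : ℂ} (hQ1 : ‖Q‖ < 1) {n : ℕ} (hn : n ≠ 0) : ‖Q ^ n‖ < 1 := by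
  rw [norm_pow]
  exact pow_lt_one₀ (norm_nonneg _) hQ1 hn

theorem theta_pow_sub {Q : ℂ} (hQ : Q ≠ 0) {m n : ℕ} (h : m ≤ n) :
    theta (Q ^ n) (Q ^ (n - m)) = theta (Q ^ n) (Q ^ m) := by
  rw [← theta_div (pow_ne_zero n hQ) (Q ^ m), pow_sub₀ _ hQ h, div_eq_mul_inv]

theorem theta_pow_ne_zero {Q : ℂ} (hQ : Q ≠ 0) (hQ1 : ‖Q‖ < 1) {m n : ℕ} (hm : m ≠ 0) (h : m < n) :
    theta (Q ^ n) (Q ^ m) ≠ 0 := by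
  refine theta_ne_zero (norm_pow_lt_one hQ1 (by omega)) ?_ (norm_pow_lt_one hQ1 hm).le ?_
  · rw [norm_pow, norm_pow]
    exact pow_lt_pow_right_of_lt_one₀ (norm_pos_iff.mpr hQ) hQ1 h
  · intro h1
    have := norm_pow_lt_one hQ1 hm
    rw [h1] at this
    simp at this

theorem theta_neg_pow_ne_zero {Q : ℂ} (hQ : Q ≠ 0) (hQ1 : ‖Q‖ < 1) {m n : ℕ} (h : m < n) :
    theta (Q ^ n) (-Q ^ m) ≠ 0 := by
  refine theta_ne_zero (norm_pow_lt_one hQ1 (by omega)) ?_ ?_ ?_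
  · rw [norm_neg, norm_pow, norm_pow]
    exact pow_lt_pow_right_of_lt_one₀ (norm_pos_iff.mpr hQ) hQ1 h
  · rw [norm_neg, norm_pow]
    exact pow_le_one₀ (norm_nonneg _) hQ1.le
  · intro h1
    rcases Nat.eq_zero_or_pos m with rfl | hm
    · norm_num at h1
    have := norm_pow_lt_one hQ1 hm.ne'
    rw [← norm_neg, h1] at this
    simp at this

theorem theta_three_term {Q : ℂ} (hQ : Q ≠ 0) (hQ1 : ‖Q‖ < 1) {n k l m : ℕ} (hn : n ≠ 0)
    (hkl : k ≤ l) (hlm : l ≤ m) :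
    Q ^ (l - k) * (theta (Q ^ n) (Q ^ (k + 1)) * theta (Q ^ n) (Q ^ k)) *
        (theta (Q ^ n) (Q ^ (m + l + 1)) * theta (Q ^ n) (Q ^ (m - l))) -
      theta (Q ^ n) (Q ^ (l + 1)) * theta (Q ^ n) (Q ^ l) *
        (theta (Q ^ n) (Q ^ (m + k + 1)) * theta (Q ^ n) (Q ^ (m - k))) +
      theta (Q ^ n) (Q ^ (m + 1)) * theta (Q ^ n) (Q ^ m) *
        (theta (Q ^ n) (Q ^ (l + k + 1)) * theta (Q ^ n) (Q ^ (l - k))) = 0 := by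
  obtain ⟨s, rfl⟩ : ∃ s, s ^ 2 = Q := IsAlgClosed.exists_pow_nat_eq Q (by norm_num)
  have hs : s ≠ 0 := by
    rintro rfl
    simp at hQ
  obtain ⟨i, rfl⟩ := Nat.exists_eq_add_of_le hkl
  obtain ⟨j, rfl⟩ := Nat.exists_eq_add_of_le hlm
  have h := theta_weierstrass (p := (s ^ 2) ^ n) (x := s ^ 1) (y := s ^ (2 * k + 1))
    (z := s ^ (2 * (k + i) + 1)) (w := s ^ (2 * (k + i + j) + 1)) (pow_ne_zero _ hQ)
    (norm_pow_lt_one hQ1 hn) (pow_ne_zero _ hs) (pow_ne_zero _ hs) (pow_ne_zero _ hs) (pow_ne_zero _ hs)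
  convert h using 9 <;> try rw [← pow_mul]
  all_goals
    (first
      | rw [eq_div_iff (pow_ne_zero _ hs), ← pow_add]
      | rw [← pow_add]) <;> congr 1 <;> omega

theorem theta_relation_one {Q : ℂ} (hQ : Q ≠ 0) (hQ1 : ‖Q‖ < 1) :
    theta (Q ^ 10) (Q ^ 2) * theta (Q ^ 10) (Q ^ 3) ^ 2 * theta (Q ^ 10) (Q ^ 4) -
      theta (Q ^ 10) (Q ^ 1) * theta (Q ^ 10) (Q ^ 4) ^ 2 * theta (Q ^ 10) (Q ^ 5) =
    Q * (theta (Q ^ 10) (Q ^ 1) * theta (Q ^ 10) (Q ^ 2) ^ 2 * theta (Q ^ 10) (Q ^ 3)) := by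
  have h := theta_three_term hQ hQ1 (n := 10) (k := 1) (l := 2) (m := 4) (by norm_num)
    (by norm_num) (by norm_num)
  have h6 := theta_pow_sub hQ (m := 4) (n := 10) (by norm_num)
  have h7 := theta_pow_sub hQ (m := 3) (n := 10) (by norm_num)
  norm_num only [] at h h6 h7
  rw [h6, h7] at h
  linear_combination -h

theorem theta_relation_two {Q : ℂ} (hQ : Q ≠ 0) (hQ1 : ‖Q‖ < 1) :
    theta (Q ^ 10) (Q ^ 2) ^ 2 * theta (Q ^ 10) (Q ^ 3) * theta (Q ^ 10) (Q ^ 5) -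
      theta (Q ^ 10) (Q ^ 1) * theta (Q ^ 10) (Q ^ 3) * theta (Q ^ 10) (Q ^ 4) ^ 2 =
    Q * (theta (Q ^ 10) (Q ^ 1) ^ 2 * theta (Q ^ 10) (Q ^ 2) * theta (Q ^ 10) (Q ^ 4)) := by
  have h := theta_three_term hQ hQ1 (n := 10) (k := 1) (l := 2) (m := 3) (by norm_num)
    (by norm_num) (by norm_num)
  have h6 := theta_pow_sub hQ (m := 4) (n := 10) (by norm_num)
  norm_num only [] at h h6
  rw [h6] at h
  linear_combination -h

end Relations

theorem residue_four_relation {a b c d e Q : ℂ}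
    (ha : a ≠ 0) (hb : b ≠ 0) (hc : c ≠ 0) (hd : d ≠ 0) (he : e ≠ 0)
    (h1 : b * c ^ 2 * d - a * d ^ 2 * e = Q * (a * b ^ 2 * c))
    (h2 : b ^ 2 * c * e - a * c * d ^ 2 = Q * (a ^ 2 * b * d)) :
    -a * d ^ 2 * e / c + b * c * d - a ^ 2 * d ^ 4 / (b ^ 2 * c) + b ^ 3 * c * e / (a * d) -
      2 * Q * b ^ 3 * c ^ 2 / (d * e) + 2 * Q * b ^ 5 * c ^ 2 / (a * d ^ 3) -
      4 * Q * a * b * c ^ 2 * d / e ^ 2 = 0 := by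
  have h3 : e * (a ^ 2 * d ^ 3 - b ^ 3 * c ^ 2) + 2 * Q * a ^ 2 * b ^ 2 * c * d = 0 := by
    linear_combination -(a * d) * h1 - b * c * h2
  have h4 : e * (a ^ 2 * d ^ 3 + b ^ 3 * c ^ 2) - 2 * a * b * c ^ 2 * d ^ 2 = 0 := by
    linear_combination -(a * d) * h1 + b * c * h2
  have h5 : e ^ 2 * (b ^ 6 * c ^ 4 - a ^ 4 * d ^ 6) - 4 * Q * a ^ 3 * b ^ 3 * c ^ 3 * d ^ 3 = 0 := by
    linear_combination -(e * (a ^ 2 * d ^ 3 + b ^ 3 * c ^ 2)) * h3 + 2 * Q * a ^ 2 * b ^ 2 * c * d * h4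
  have key : -a * d ^ 2 * e / c + b * c * d - a ^ 2 * d ^ 4 / (b ^ 2 * c) + b ^ 3 * c * e / (a * d) -
      2 * Q * b ^ 3 * c ^ 2 / (d * e) + 2 * Q * b ^ 5 * c ^ 2 / (a * d ^ 3) -
      4 * Q * a * b * c ^ 2 * d / e ^ 2 =
      (e ^ 2 * (b ^ 6 * c ^ 4 - a ^ 4 * d ^ 6) - 4 * Q * a ^ 3 * b ^ 3 * c ^ 3 * d ^ 3) /
        (a ^ 2 * b ^ 2 * c * d ^ 2 * e ^ 2) +
      (b * c ^ 2 - a * d * e) * (e * (a ^ 2 * d ^ 3 - b ^ 3 * c ^ 2) + 2 * Q * a ^ 2 * b ^ 2 * c * d) /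
        (a ^ 2 * c * d ^ 2 * e) +
      2 * Q * b ^ 2 * (e * (a ^ 2 * d ^ 3 + b ^ 3 * c ^ 2) - 2 * a * b * c ^ 2 * d ^ 2) /
        (a * d ^ 3 * e) := by
    field_simp
    ring
  rw [key, h3, h4, h5]
  simp

section Dissections

theorem theta_neg_pow_sub {Q : ℂ} (hQ : Q ≠ 0) {m n : ℕ} (h : m ≤ n) :
    theta (Q ^ n) (-Q ^ (n - m)) = theta (Q ^ n) (-Q ^ m) := by
  rw [← theta_div (pow_ne_zero n hQ) (-Q ^ m), pow_sub₀ _ hQ h, div_neg, div_eq_mul_inv]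

theorem norm_lt_one_of_pow {q : ℂ} {n : ℕ} (h : ‖q ^ n‖ < 1) : ‖q‖ < 1 := by
  by_contra hq
  rw [norm_pow] at h
  exact h.not_ge (one_le_pow₀ (not_lt.mp hq))

theorem norm_pow_lt_norm_pow {q : ℂ} (hq : q ≠ 0) (hq1 : ‖q‖ < 1) {m n : ℕ} (h : m < n) :
    ‖q ^ n‖ < ‖q ^ m‖ := by
  rw [norm_pow, norm_pow]
  exact pow_lt_pow_right_of_lt_one₀ (norm_pos_iff.mpr hq) hq1 h

theorem exists_theta_pow_four_div {Q : ℂ} (hQ : Q ≠ 0) (hQ1 : ‖Q‖ < 1) :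
    ∃ K, ∀ q, q ^ 5 = Q → theta (q ^ 10) (q ^ 4) / theta (q ^ 10) q =
      K * (theta (Q ^ 10) (Q ^ 2) / theta (Q ^ 10) (Q ^ 1) +
        q * (theta (Q ^ 10) (Q ^ 4) / theta (Q ^ 10) (Q ^ 3)) +
        q ^ 2 * (theta (Q ^ 10) (Q ^ 4) / theta (Q ^ 10) (Q ^ 5)) +
        q ^ 3 * (theta (Q ^ 10) (Q ^ 2) / theta (Q ^ 10) (Q ^ 3))) := by
  obtain ⟨K, -, h⟩ := exists_thetaQuot_eq_sum (pow_ne_zero 2 hQ) (norm_pow_lt_one hQ1 two_ne_zero)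
  refine ⟨theta (Q ^ 2) Q * K / theta (Q ^ 10) (Q ^ 1), fun q hq => ?_⟩
  have hq0 : q ≠ 0 := by
    rintro rfl
    simp [← hq] at hQ
  have hq1 : ‖q‖ < 1 := norm_lt_one_of_pow (n := 5) (by rwa [hq])
  have h10 : q ^ 10 = Q ^ 2 := by rw [← hq, ← pow_mul]
  have hQ5 : theta (Q ^ 2) Q ≠ 0 := by
    simpa using theta_pow_ne_zero hQ hQ1 (m := 1) (n := 2) (by norm_num) (by norm_num)
  have hne1 : ∀ {x : ℂ}, ‖x‖ < 1 → x ≠ 1 := by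
    rintro x hx rfl
    simp at hx
  have hsum := h Q q (by simpa using norm_pow_lt_norm_pow hQ hQ1 (m := 1) (n := 2) (by norm_num))
    hQ1.le (hne1 hQ1)
    (by simpa [← h10] using norm_pow_lt_norm_pow hq0 hq1 (m := 1) (n := 10) (by norm_num)) hq1
  have hlhs : theta (q ^ 10) (q ^ 4) = theta (Q ^ 2) (Q * q) := by
    rw [← theta_pow_sub hq0 (m := 4) (n := 10) (by norm_num), h10, ← hq, ← pow_succ]
  have h6 : theta (Q ^ 10) (Q ^ 6) = theta (Q ^ 10) (Q ^ 4) :=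
    theta_pow_sub hQ (m := 4) (n := 10) (by norm_num)
  have h7 : theta (Q ^ 10) (Q ^ 7) = theta (Q ^ 10) (Q ^ 3) :=
    theta_pow_sub hQ (m := 3) (n := 10) (by norm_num)
  have h8 : theta (Q ^ 10) (Q ^ 8) = theta (Q ^ 10) (Q ^ 2) :=
    theta_pow_sub hQ (m := 2) (n := 10) (by norm_num)
  have h0 : theta (Q ^ 10) (Q ^ 10) = 0 := by
    have := theta_pow_sub hQ (m := 0) (n := 10) (by norm_num)
    rwa [pow_zero, theta_one (norm_pow_lt_one hQ1 (by norm_num))] at this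
  have hterm : ∀ r : ℕ, thetaQuot ((Q ^ 2) ^ 5) (Q * (Q ^ 2) ^ r) (q ^ 5) =
      theta (Q ^ 10) (Q ^ (2 * r + 2)) / (theta (Q ^ 10) (Q ^ (2 * r + 1)) * theta (Q ^ 10) (Q ^ 1)) := by
    intro r
    rw [thetaQuot, hq]
    ring_nf
  simp only [hterm, Finset.sum_range_succ, Finset.sum_range_zero] at hsum
  norm_num only [] at hsum
  rw [thetaQuot, h6, h7, h8, h0] at hsum
  rw [hlhs, h10]
  rw [← mul_div_mul_left _ _ hQ5, mul_div_assoc, hsum]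
  ring

theorem exists_theta_neg_sq_div {Q : ℂ} (hQ : Q ≠ 0) (hQ1 : ‖Q‖ < 1) :
    ∃ K, ∀ q, q ^ 5 = Q → theta (q ^ 5) (-q ^ 2) / theta (q ^ 5) (q ^ 2) =
      K * (theta (Q ^ 5) (-Q ^ 2) / theta (Q ^ 5) (-Q ^ 0) +
        q ^ 2 * (theta (Q ^ 5) (-Q ^ 2) / theta (Q ^ 5) (-Q ^ 1)) +
        q ^ 4 * (theta (Q ^ 5) (-Q ^ 1) / theta (Q ^ 5) (-Q ^ 2)) +
        Q * q * (theta (Q ^ 5) (-Q ^ 0) / theta (Q ^ 5) (-Q ^ 2)) + q ^ 3) := by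
  obtain ⟨K, -, h⟩ := exists_thetaQuot_eq_sum hQ hQ1
  refine ⟨theta Q (-1) * K / theta (Q ^ 5) (Q ^ 2), fun q hq => ?_⟩
  have hq0 : q ≠ 0 := by
    rintro rfl
    simp [← hq] at hQ
  have hq1 : ‖q‖ < 1 := norm_lt_one_of_pow (n := 5) (by rwa [hq])
  have hm0 : theta Q (-1) ≠ 0 := by
    simpa using theta_neg_pow_ne_zero hQ hQ1 (m := 0) (n := 1) (by norm_num)
  have hm1 : theta (Q ^ 5) (-Q ^ 1) ≠ 0 := theta_neg_pow_ne_zero hQ hQ1 (by norm_num)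
  have hsum := h (-1) (q ^ 2) (by simpa using hQ1) (by simp) (by norm_num)
    (by simpa [hq] using norm_pow_lt_norm_pow hq0 hq1 (m := 2) (n := 5) (by norm_num))
    (norm_pow_lt_one hq1 two_ne_zero)
  have h3 : theta (Q ^ 5) (-Q ^ 3) = theta (Q ^ 5) (-Q ^ 2) :=
    theta_neg_pow_sub hQ (m := 2) (n := 5) (by norm_num)
  have h4 : theta (Q ^ 5) (-Q ^ 4) = theta (Q ^ 5) (-Q ^ 1) :=
    theta_neg_pow_sub hQ (m := 1) (n := 5) (by norm_num)
  have h5 : theta (Q ^ 5) (-Q ^ 5) = theta (Q ^ 5) (-Q ^ 0) :=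
    theta_neg_pow_sub hQ (m := 0) (n := 5) (by norm_num)
  have h6 : theta (Q ^ 5) (-Q ^ 6) = Q⁻¹ * theta (Q ^ 5) (-Q ^ 1) := by
    have := theta_mul_left (z := -Q ^ 1) (pow_ne_zero 5 hQ) (norm_pow_lt_one hQ1 (by norm_num))
      (neg_ne_zero.mpr (pow_ne_zero 1 hQ))
    rw [mul_neg, ← pow_add] at this
    simpa [inv_neg] using this
  have hterm : ∀ r : ℕ, thetaQuot (Q ^ 5) (-1 * Q ^ r) ((q ^ 2) ^ 5) =
      theta (Q ^ 5) (-Q ^ (r + 2)) / (theta (Q ^ 5) (-Q ^ r) * theta (Q ^ 5) (Q ^ 2)) := by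
    intro r
    rw [thetaQuot, ← pow_mul, mul_comm 2 5, pow_mul, hq]
    ring_nf
  simp only [hterm, Finset.sum_range_succ, Finset.sum_range_zero] at hsum
  norm_num only [] at hsum
  rw [thetaQuot, h3, h4, h5, h6] at hsum
  rw [← mul_div_mul_left _ _ hm0, mul_div_assoc, hq, ← neg_one_mul (q ^ 2), hsum]
  have h7 : q ^ 6 = Q * q := by rw [← hq]; ring
  have h8 : q ^ 8 * Q⁻¹ = q ^ 3 := by
    rw [← hq]
    field_simp
  have h9 : Q⁻¹ * theta (Q ^ 5) (-Q ^ 1) / (theta (Q ^ 5) (-Q ^ 1) * theta (Q ^ 5) (Q ^ 2)) =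
      Q⁻¹ / theta (Q ^ 5) (Q ^ 2) := by
    rw [mul_comm, mul_div_mul_left _ _ hm1]
  rw [h9]
  linear_combination (theta Q (-1) * K / theta (Q ^ 5) (Q ^ 2)) *
    (theta (Q ^ 5) (-Q ^ 0) / theta (Q ^ 5) (-Q ^ 2) * h7 + h8)

theorem exists_theta_div_theta_neg {Q : ℂ} (hQ : Q ≠ 0) (hQ1 : ‖Q‖ < 1) :
    ∃ K, ∀ q, q ^ 5 = Q → theta (q ^ 5) q / theta (q ^ 5) (-q) =
      K * (theta (Q ^ 5) (Q ^ 1) / theta (Q ^ 5) (-Q ^ 0) -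
        q * (theta (Q ^ 5) (Q ^ 2) / theta (Q ^ 5) (-Q ^ 1)) +
        q ^ 2 * (theta (Q ^ 5) (Q ^ 2) / theta (Q ^ 5) (-Q ^ 2)) -
        q ^ 3 * (theta (Q ^ 5) (Q ^ 1) / theta (Q ^ 5) (-Q ^ 2))) := by
  obtain ⟨K, -, h⟩ := exists_thetaQuot_eq_sum hQ hQ1
  refine ⟨theta Q (-1) * K / theta (Q ^ 5) (-Q ^ 1), fun q hq => ?_⟩
  have hq0 : q ≠ 0 := by
    rintro rfl
    simp [← hq] at hQ
  have hq1 : ‖q‖ < 1 := norm_lt_one_of_pow (n := 5) (by rwa [hq])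
  have hm0 : theta Q (-1) ≠ 0 := by
    simpa using theta_neg_pow_ne_zero hQ hQ1 (m := 0) (n := 1) (by norm_num)
  have hsum := h (-1) (-q) (by simpa using hQ1) (by simp) (by norm_num)
    (by simpa [hq] using norm_pow_lt_norm_pow hq0 hq1 (m := 1) (n := 5) (by norm_num))
    (by simpa using hq1)
  have h3 : theta (Q ^ 5) (-Q ^ 3) = theta (Q ^ 5) (-Q ^ 2) :=
    theta_neg_pow_sub hQ (m := 2) (n := 5) (by norm_num)
  have ht3 : theta (Q ^ 5) (Q ^ 3) = theta (Q ^ 5) (Q ^ 2) :=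
    theta_pow_sub hQ (m := 2) (n := 5) (by norm_num)
  have ht4 : theta (Q ^ 5) (Q ^ 4) = theta (Q ^ 5) (Q ^ 1) :=
    theta_pow_sub hQ (m := 1) (n := 5) (by norm_num)
  have ht5 : theta (Q ^ 5) (Q ^ 5) = 0 := by
    have := theta_pow_sub hQ (m := 0) (n := 5) (by norm_num)
    rwa [pow_zero, theta_one (norm_pow_lt_one hQ1 (by norm_num))] at this
  have hterm : ∀ r : ℕ, thetaQuot (Q ^ 5) (-1 * Q ^ r) ((-q) ^ 5) =
      theta (Q ^ 5) (Q ^ (r + 1)) / (theta (Q ^ 5) (-Q ^ r) * theta (Q ^ 5) (-Q ^ 1)) := by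
    intro r
    rw [thetaQuot, Odd.neg_pow (by decide), hq]
    ring_nf
  simp only [hterm, Finset.sum_range_succ, Finset.sum_range_zero] at hsum
  norm_num only [] at hsum
  rw [thetaQuot, h3, ht3, ht4, ht5] at hsum
  have hlhs : theta Q q = theta Q (-1 * -q) := by rw [neg_one_mul, neg_neg]
  rw [← mul_div_mul_left _ _ hm0, mul_div_assoc, hq, hlhs, hsum]
  ring


theorem mul_eq_of_pow_five {q Q : ℂ} (hq : q ^ 5 = Q) (a₀ a₁ a₂ a₃ a₄ b₀ b₁ b₂ b₃ b₄ : ℂ) :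
    (a₀ + q * a₁ + q ^ 2 * a₂ + q ^ 3 * a₃ + q ^ 4 * a₄) *
        (b₀ + q * b₁ + q ^ 2 * b₂ + q ^ 3 * b₃ + q ^ 4 * b₄) =
      a₀ * b₀ + Q * (a₁ * b₄ + a₂ * b₃ + a₃ * b₂ + a₄ * b₁) +
      q * (a₀ * b₁ + a₁ * b₀ + Q * (a₂ * b₄ + a₃ * b₃ + a₄ * b₂)) +
      q ^ 2 * (a₀ * b₂ + a₁ * b₁ + a₂ * b₀ + Q * (a₃ * b₄ + a₄ * b₃)) +
      q ^ 3 * (a₀ * b₃ + a₁ * b₂ + a₂ * b₁ + a₃ * b₀ + Q * (a₄ * b₄)) +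
      q ^ 4 * (a₀ * b₄ + a₁ * b₃ + a₂ * b₂ + a₃ * b₁ + a₄ * b₀) := by
  rw [← hq]
  ring

theorem exists_mul_mul_eq_of_pow_five {Q a₀ a₁ a₂ a₃ a₄ b₀ b₁ b₂ b₃ b₄ c₀ c₁ c₂ c₃ c₄ : ℂ}
    (h : a₀ * (b₀ * c₄ + b₁ * c₃ + b₂ * c₂ + b₃ * c₁ + b₄ * c₀) +
      a₁ * (b₀ * c₃ + b₁ * c₂ + b₂ * c₁ + b₃ * c₀ + Q * (b₄ * c₄)) +
      a₂ * (b₀ * c₂ + b₁ * c₁ + b₂ * c₀ + Q * (b₃ * c₄ + b₄ * c₃)) +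
      a₃ * (b₀ * c₁ + b₁ * c₀ + Q * (b₂ * c₄ + b₃ * c₃ + b₄ * c₂)) +
      a₄ * (b₀ * c₀ + Q * (b₁ * c₄ + b₂ * c₃ + b₃ * c₂ + b₄ * c₁)) = 0) :
    ∃ d₀ d₁ d₂ d₃ : ℂ, ∀ q, q ^ 5 = Q →
      (a₀ + q * a₁ + q ^ 2 * a₂ + q ^ 3 * a₃ + q ^ 4 * a₄) *
        ((b₀ + q * b₁ + q ^ 2 * b₂ + q ^ 3 * b₃ + q ^ 4 * b₄) *
          (c₀ + q * c₁ + q ^ 2 * c₂ + q ^ 3 * c₃ + q ^ 4 * c₄)) =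
      d₀ + q * d₁ + q ^ 2 * d₂ + q ^ 3 * d₃ := by
  exact ⟨_, _, _, _, fun q hq =>
    (congrArg _ (mul_eq_of_pow_five hq b₀ b₁ b₂ b₃ b₄ c₀ c₁ c₂ c₃ c₄)).trans <|
      (mul_eq_of_pow_five hq a₀ a₁ a₂ a₃ a₄ _ _ _ _ _).trans <|
        add_eq_left.mpr (by rw [h, mul_zero])⟩

/-- The infinite product generating `δ`, in terms of theta functions. -/
noncomputable def deltaProd (q : ℂ) : ℂ :=
  theta (q ^ 10) (q ^ 4) / theta (q ^ 10) q *
    (theta (q ^ 5) (-q ^ 2) / theta (q ^ 5) (q ^ 2) * (theta (q ^ 5) q / theta (q ^ 5) (-q)))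

theorem exists_deltaProd_eq {Q : ℂ} (hQ : Q ≠ 0) (hQ1 : ‖Q‖ < 1) :
    ∃ c₀ c₁ c₂ c₃, ∀ q, q ^ 5 = Q → deltaProd q = c₀ + q * c₁ + q ^ 2 * c₂ + q ^ 3 * c₃ := by
  obtain ⟨K, hA⟩ := exists_theta_pow_four_div hQ hQ1
  obtain ⟨L, hX⟩ := exists_theta_neg_sq_div hQ hQ1
  obtain ⟨M, hY⟩ := exists_theta_div_theta_neg hQ hQ1
  have hQ5 := norm_pow_lt_one hQ1 (n := 5) (by norm_num)
  have e1 : theta (Q ^ 5) (Q ^ 1) = theta (Q ^ 10) (Q ^ 1) * theta (Q ^ 10) (Q ^ 4) := by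
    rw [theta_eq_mul (pow_ne_zero 5 hQ) hQ5, ← pow_mul, ← pow_add,
      theta_pow_sub hQ (m := 4) (n := 10) (by norm_num)]
  have e2 : theta (Q ^ 5) (Q ^ 2) = theta (Q ^ 10) (Q ^ 2) * theta (Q ^ 10) (Q ^ 3) := by
    rw [theta_eq_mul (pow_ne_zero 5 hQ) hQ5, ← pow_mul, ← pow_add,
      theta_pow_sub hQ (m := 3) (n := 10) (by norm_num)]
  have e3 : theta (Q ^ 5) (Q ^ 1) * theta (Q ^ 5) (-Q ^ 1) = theta (Q ^ 10) (Q ^ 2) := by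
    rw [theta_mul_theta_neg hQ5, ← pow_mul, ← pow_mul]
  have e4 : theta (Q ^ 5) (Q ^ 2) * theta (Q ^ 5) (-Q ^ 2) = theta (Q ^ 10) (Q ^ 4) := by
    rw [theta_mul_theta_neg hQ5, ← pow_mul, ← pow_mul]
  have e5 : theta (Q ^ 5) (-Q ^ 0) * theta (Q ^ 10) (Q ^ 5) = 2 := by
    rw [pow_zero, ← theta_neg_one_mul (pow_ne_zero 5 hQ) hQ5, ← pow_mul]
  have r1 := theta_relation_one hQ hQ1
  have r2 := theta_relation_two hQ hQ1
  have ha : theta (Q ^ 10) (Q ^ 1) ≠ 0 := theta_pow_ne_zero hQ hQ1 (by norm_num) (by norm_num)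
  have hb : theta (Q ^ 10) (Q ^ 2) ≠ 0 := theta_pow_ne_zero hQ hQ1 (by norm_num) (by norm_num)
  have hc : theta (Q ^ 10) (Q ^ 3) ≠ 0 := theta_pow_ne_zero hQ hQ1 (by norm_num) (by norm_num)
  have hd : theta (Q ^ 10) (Q ^ 4) ≠ 0 := theta_pow_ne_zero hQ hQ1 (by norm_num) (by norm_num)
  have he : theta (Q ^ 10) (Q ^ 5) ≠ 0 := theta_pow_ne_zero hQ hQ1 (by norm_num) (by norm_num)
  rw [e1] at e3
  rw [e2] at e4
  simp only [e1, e2] at hX hY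
  generalize theta (Q ^ 10) (Q ^ 1) = a at *
  generalize theta (Q ^ 10) (Q ^ 2) = b at *
  generalize theta (Q ^ 10) (Q ^ 3) = c at *
  generalize theta (Q ^ 10) (Q ^ 4) = d at *
  generalize theta (Q ^ 10) (Q ^ 5) = e at *
  have hm0 := eq_div_of_mul_eq he e5
  have hm1 := eq_div_of_mul_eq (mul_ne_zero ha hd) ((mul_comm _ _).trans e3)
  have hm2 := eq_div_of_mul_eq (mul_ne_zero hb hc) ((mul_comm _ _).trans e4)
  rw [hm0, hm1, hm2] at hX hY
  have key := residue_four_relation ha hb hc hd he r1 r2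
  obtain ⟨d₀, d₁, d₂, d₃, h⟩ := exists_mul_mul_eq_of_pow_five (Q := Q)
    (a₀ := b / a) (a₁ := d / c) (a₂ := d / e) (a₃ := b / c) (a₄ := 0)
    (b₀ := d / (b * c) / (2 / e)) (b₁ := Q * (2 / e / (d / (b * c))))
    (b₂ := d / (b * c) / (b / (a * d))) (b₃ := 1) (b₄ := b / (a * d) / (d / (b * c)))
    (c₀ := a * d / (2 / e)) (c₁ := -(b * c / (b / (a * d)))) (c₂ := b * c / (d / (b * c)))
    (c₃ := -(a * d / (d / (b * c)))) (c₄ := 0) (by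
      refine Eq.trans ?_ (mul_eq_zero_of_right (2⁻¹ : ℂ) key)
      field_simp
      ring)
  refine ⟨K * L * M * d₀, K * L * M * d₁, K * L * M * d₂, K * L * M * d₃, fun q hq => ?_⟩
  rw [deltaProd, hA q hq, hX q hq, hY q hq]
  linear_combination K * L * M * h q hq

end Dissections

section Extraction

theorem eq_zero_of_hasSum_zero {a : ℕ → ℂ}
    (h : ∀ q : ℂ, ‖q‖ < 1 → HasSum (fun n => a n * q ^ n) 0) (n : ℕ) : a n = 0 := by
  have hp : HasFPowerSeriesAt (0 : ℂ → ℂ) (FormalMultilinearSeries.ofScalars ℂ a) 0 := by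
    rw [hasFPowerSeriesAt_iff]
    filter_upwards [Metric.ball_mem_nhds (0 : ℂ) one_pos] with q hq
    simpa [FormalMultilinearSeries.coeff_ofScalars, mul_comm] using h q (by simpa using hq)
  rw [← FormalMultilinearSeries.coeff_ofScalars (𝕜 := ℂ) (p := a), hp.eq_zero]
  rfl

theorem eq_zero_of_fifth_dissection {δ : ℕ → ℂ} {F : ℂ → ℂ}
    (h : ∀ q : ℂ, ‖q‖ < 1 → HasSum (fun n => δ n * q ^ n) (F q))
    (hF : ∀ Q : ℂ, Q ≠ 0 → ‖Q‖ < 1 →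
      ∃ c₀ c₁ c₂ c₃, ∀ q, q ^ 5 = Q → F q = c₀ + q * c₁ + q ^ 2 * c₂ + q ^ 3 * c₃) (n : ℕ) :
    δ (5 * n + 4) = 0 := by
  obtain ⟨ζ, hζ⟩ : ∃ ζ : ℂ, IsPrimitiveRoot ζ 5 :=
    ⟨_, Complex.isPrimitiveRoot_exp 5 (by norm_num)⟩
  have hζ1 : ‖ζ‖ = 1 := hζ.norm'_eq_one (by norm_num)
  have hS : ∀ k, Nat.Coprime k 5 → ∑ j ∈ Finset.range 5, (ζ ^ k) ^ j = 0 := fun k hk =>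
    (hζ.pow_of_coprime k hk).geom_sum_eq_zero (by norm_num)
  have hfilter : ∀ q : ℂ, ‖q‖ < 1 → ∑ j ∈ Finset.range 5, ζ ^ j * F (ζ ^ j * q) = 0 := by
    intro q hq
    rcases eq_or_ne q 0 with rfl | hq0
    · simpa [Finset.sum_mul] using congrArg (· * F 0) (hS 1 (by norm_num))
    obtain ⟨c₀, c₁, c₂, c₃, hc⟩ := hF (q ^ 5) (pow_ne_zero 5 hq0) (norm_pow_lt_one hq (by norm_num))
    have hζ5 : ∀ j : ℕ, (ζ ^ j * q) ^ 5 = q ^ 5 := fun j => by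
      rw [mul_pow, pow_right_comm, hζ.pow_eq_one, one_pow, one_mul]
    have h1 := hS 1 (by norm_num)
    have h2 := hS 2 (by norm_num)
    have h3 := hS 3 (by norm_num)
    have h4 := hS 4 (by norm_num)
    simp only [hc _ (hζ5 _), Finset.sum_range_succ, Finset.sum_range_zero] at h1 h2 h3 h4 ⊢
    linear_combination c₀ * h1 + q * c₁ * h2 + q ^ 2 * c₂ * h3 + q ^ 3 * c₃ * h4
  have hzero := eq_zero_of_hasSum_zero
    (a := fun n => δ n * ∑ j ∈ Finset.range 5, (ζ ^ (n + 1)) ^ j) (fun q hq => by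
      have := hasSum_sum (s := Finset.range 5) fun j _ =>
        (h (ζ ^ j * q) (by simpa [hζ1] using hq)).mul_left (ζ ^ j)
      rw [hfilter q hq] at this
      refine this.congr_fun fun n => ?_
      rw [Finset.mul_sum, Finset.sum_mul]
      exact Finset.sum_congr rfl fun j _ => by ring) (5 * n + 4)
  have hone : ζ ^ (5 * n + 4 + 1) = 1 := by
    rw [show 5 * n + 4 + 1 = 5 * (n + 1) by ring, pow_mul, hζ.pow_eq_one, one_pow]
  simpa [hone] using hzero

theorem deltaProd_eq {q : ℂ} (hq0 : q ≠ 0) (hq1 : ‖q‖ < 1) :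
    (qp (-(q ^ 2)) (q ^ 5) * qp (-(q ^ 3)) (q ^ 5)) ^ 2 * (qp (q ^ 2) (q ^ 10) * qp (q ^ 8) (q ^ 10)) /
      ((qp (-q) (q ^ 5) * qp (-(q ^ 4)) (q ^ 5)) ^ 2 * (qp q (q ^ 10) * qp (q ^ 9) (q ^ 10))) =
    deltaProd q := by
  have hq5 := norm_pow_lt_one hq1 (n := 5) (by norm_num)
  have d1 : q ^ 5 / -q ^ 2 = -q ^ 3 := by field_simp
  have d2 : q ^ 5 / -q = -q ^ 4 := by field_simp
  have d3 : q ^ 10 / q ^ 2 = q ^ 8 := by field_simp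
  have d4 : q ^ 10 / q = q ^ 9 := by field_simp
  have e1 : qp (-q ^ 2) (q ^ 5) * qp (-q ^ 3) (q ^ 5) = theta (q ^ 5) (-q ^ 2) := by rw [theta, d1]
  have e2 : qp (-q) (q ^ 5) * qp (-q ^ 4) (q ^ 5) = theta (q ^ 5) (-q) := by rw [theta, d2]
  have e3 : qp (q ^ 2) (q ^ 10) * qp (q ^ 8) (q ^ 10) = theta (q ^ 5) q * theta (q ^ 5) (-q) := by
    rw [theta_mul_theta_neg hq5, ← pow_mul, theta, d3]
  have e4 : qp q (q ^ 10) * qp (q ^ 9) (q ^ 10) = theta (q ^ 10) q := by rw [theta, d4]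
  have e5 : theta (q ^ 10) (q ^ 4) = theta (q ^ 5) (q ^ 2) * theta (q ^ 5) (-q ^ 2) := by
    rw [theta_mul_theta_neg hq5, ← pow_mul, ← pow_mul]
  have h2 : theta (q ^ 5) (q ^ 2) ≠ 0 := theta_pow_ne_zero hq0 hq1 (by norm_num) (by norm_num)
  have h1 : theta (q ^ 5) (-q) ≠ 0 := by
    simpa using theta_neg_pow_ne_zero hq0 hq1 (m := 1) (n := 5) (by norm_num)
  rw [deltaProd, e1, e2, e3, e4, e5]
  field_simp

end Extraction

theorem stmt_19 : ∀ δ : ℕ → ℂ,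
    (∀ q : ℂ, ‖q‖ < 1 →
      HasSum (fun n : ℕ => δ n * q ^ n)
        ((qp (-(q ^ 2)) (q ^ 5) * qp (-(q ^ 3)) (q ^ 5)) ^ 2 * (qp (q ^ 2) (q ^ 10) * qp (q ^ 8) (q ^ 10)) /
          ((qp (-q) (q ^ 5) * qp (-(q ^ 4)) (q ^ 5)) ^ 2 * (qp q (q ^ 10) * qp (q ^ 9) (q ^ 10))))) →
    ∀ n : ℕ, δ (5 * n + 4) = 0 := by
  intro δ hδ
  refine eq_zero_of_fifth_dissection hδ fun Q hQ hQ1 => ?_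
  obtain ⟨c₀, c₁, c₂, c₃, hc⟩ := exists_deltaProd_eq hQ hQ1
  refine ⟨c₀, c₁, c₂, c₃, fun q hq => ?_⟩
  have hq0 : q ≠ 0 := by
    rintro rfl
    simp [← hq] at hQ
  rw [← hc q hq, deltaProd_eq hq0 (norm_lt_one_of_pow (n := 5) (by rwa [hq]))]
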